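/- arXiv:2109.09230 — 3 statements merged into one kernel-verified Lean document; each statement's English description precedes it below -/
import Mathlib

section
/- Let U ⊆ ℂ be a connected open set and let f be holomorphic on U and transcendental over ℂ(z) in 𝓜(U). Suppose h ≥ 2 and P ∈ ℂ[T, Y₀, Y₁, …, Y_h] is a polynomial genuinely involving Y_h such that P(z, f(z), f′(z), …, f⁽ʰ⁾(z)) = 0 for all z ∈ U, and suppose the equation P = 0 is strongly minimal in the transcendence sense. Then for every ℂ-Pfaffian chain (f₁, …, f_l) on U, f is not algebraic over ℂ(z, f₁, …, f_l); in particular f is not ℂ-Pfaffian on U. -/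
/-- `(f 0, …, f (l-1))` is a ℂ-Pfaffian chain of holomorphic functions on `V ⊆ ℂ`. -/
def CPfaffianChain (V : Set ℂ) {l : ℕ} (f : Fin l → ℂ → ℂ) : Prop :=
  (∀ i, DifferentiableOn ℂ (f i) V) ∧
  ∀ i : Fin l, ∃ p : MvPolynomial (Fin ((i : ℕ) + 2)) ℂ,
    ∀ z ∈ V, deriv (f i) z =
      MvPolynomial.eval
        (Fin.cons z fun j : Fin ((i : ℕ) + 1) => f (Fin.castLE i.isLt j) z) p

/-- `g` is algebraic over the subfield `ℂ(z, f₁, …, f_l)` of the field of meromorphic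
functions on `V`. -/
def AlgebraicOverCChain (V : Set ℂ) {l : ℕ} (f : Fin l → ℂ → ℂ) (g : ℂ → ℂ) : Prop :=
  ∃ n : ℕ, ∃ c : Fin (n + 1) → MvPolynomial (Fin (l + 1)) ℂ,
    (∃ k, ¬ ∀ z ∈ V, MvPolynomial.eval (Fin.cons z fun j => f j z) (c k) = 0) ∧
    ∀ z ∈ V, ∑ k : Fin (n + 1),
      MvPolynomial.eval (Fin.cons z fun j => f j z) (c k) * g z ^ (k : ℕ) = 0

/-- `g` is ℂ-Pfaffian on `V`. -/
def IsCPfaffian (V : Set ℂ) (g : ℂ → ℂ) : Prop :=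
  ∃ (l : ℕ) (f : Fin l → ℂ → ℂ), CPfaffianChain V f ∧
    ∃ p : MvPolynomial (Fin (l + 1)) ℂ,
      ∀ z ∈ V, g z = MvPolynomial.eval (Fin.cons z fun j => f j z) p

/-- The algebraic differential equation `P(t, y, y', …, y⁽ʰ⁾) = 0` (variable `0` of `P` is
`T ↦ t`, variable `i+1` is `Yᵢ ↦ y⁽ⁱ⁾`) is strongly minimal in the transcendence sense: for
every differential field `F` of characteristic 0 containing `ℂ(t)` (with `ℂ` constants and
`t' = 1`), every differential field extension `E` of `F`, and every `a ∈ E` with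
`P(t, a, a', …, a⁽ʰ⁾) = 0`, either `a` is algebraic over `F` or `a, a', …, a⁽ʰ⁻¹⁾` are
algebraically independent over `F`. -/
def StronglyMinimalODE (h : ℕ) (P : MvPolynomial (Fin (h + 2)) ℂ) : Prop :=
  ∀ (E : Type) [Field E] [CharZero E], ∀ D : E → E,
    (∀ x y : E, D (x + y) = D x + D y) →
    (∀ x y : E, D (x * y) = x * D y + D x * y) →
    ∀ F : Subfield E, (∀ x ∈ F, D x ∈ F) →
    ∀ ι : ℂ →+* E, (∀ c : ℂ, ι c ∈ F) → (∀ c : ℂ, D (ι c) = 0) →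
    ∀ t : E, t ∈ F → D t = 1 →
    ∀ a : E,
      MvPolynomial.eval₂ ι (Fin.cons t fun i : Fin (h + 1) => D^[(i : ℕ)] a) P = 0 →
      IsAlgebraic F a ∨ AlgebraicIndependent F fun i : Fin h => D^[(i : ℕ)] a


open Polynomial in
theorem aux_deriv_aeval {E : Type} [Field E] [Algebra ℂ E] (d : Derivation ℂ E E)
    (K : IntermediateField ℂ E) (hK : ∀ x ∈ K, d x ∈ K) (a : E) (p : K[X]) :
    ∃ q : K[X], d (aeval a p) = aeval a q + aeval a (derivative p) * d a := by
  induction p using Polynomial.induction_on' with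
  | add p r hp hr =>
    obtain ⟨q1, h1⟩ := hp
    obtain ⟨q2, h2⟩ := hr
    refine ⟨q1 + q2, ?_⟩
    simp only [map_add, h1, h2]
    ring
  | monomial n c =>
    refine ⟨monomial n (⟨d c, hK c c.2⟩ : K), ?_⟩
    simp only [aeval_monomial, Derivation.leibniz, Derivation.leibniz_pow, derivative_monomial,
      smul_eq_mul, nsmul_eq_mul, map_mul, map_natCast, IntermediateField.algebraMap_apply]
    ring

open Polynomial in
theorem aux_deriv_alg {E : Type} [Field E] [Algebra ℂ E] (d : Derivation ℂ E E)
    (K : IntermediateField ℂ E) (hK : ∀ x ∈ K, d x ∈ K) (a : E) (ha : IsAlgebraic K a) :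
    IsAlgebraic K (d a) := by
  have hint : IsIntegral K a := ha.isIntegral
  obtain ⟨q, hq⟩ := aux_deriv_aeval d K hK a (minpoly K a)
  rw [minpoly.aeval, map_zero] at hq
  have : CharZero K := charZero_of_injective_algebraMap (algebraMap ℂ K).injective
  have hsep : (minpoly K a).Separable := (minpoly.irreducible hint).separable
  have hne : aeval a (derivative (minpoly K a)) ≠ 0 := hsep.aeval_derivative_ne_zero (minpoly.aeval K a)
  have hal : ∀ r : K[X], IsAlgebraic K (aeval a r) := fun r => by
    rw [isAlgebraic_iff_isIntegral]
    exact adjoin_le_integralClosure hint (aeval_mem_adjoin_singleton K a)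
  have : d a = -(aeval a q) * (aeval a (derivative (minpoly K a)))⁻¹ := by
    field_simp
    linear_combination -hq
  rw [this]
  exact (hal q).neg.mul (hal _).inv

theorem aux_adjoin_closed {E : Type} [Field E] [Algebra ℂ E] (d : Derivation ℂ E E)
    (S : Set E) (hS : ∀ s ∈ S, d s ∈ IntermediateField.adjoin ℂ S) :
    ∀ x ∈ IntermediateField.adjoin ℂ S, d x ∈ IntermediateField.adjoin ℂ S := by
  intro x hx
  induction hx using IntermediateField.adjoin_induction with
  | mem x hx => exact hS x hx
  | algebraMap c => simp
  | add x y _ _ hx hy => rw [map_add]; exact add_mem hx hy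
  | inv x hx' hx =>
    rw [Derivation.leibniz_inv, smul_eq_mul]
    exact mul_mem (neg_mem (pow_mem (inv_mem hx') 2)) hx
  | mul x y hx' hy' hx hy =>
    rw [Derivation.leibniz]
    exact add_mem (mul_mem hx' hy) (mul_mem hy' hx)

open scoped IntermediateField.algebraAdjoinAdjoin in
theorem aux_exchange {k E : Type} [Field k] [Field E] [Algebra k E] (g a b : E)
    (ha : IsAlgebraic (IntermediateField.adjoin k {g}) a)
    (hb : IsAlgebraic (IntermediateField.adjoin k {g}) b) :
    ¬ AlgebraicIndependent k ![a, b] := by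
  intro hind
  have key : ∀ x : E, IsAlgebraic (IntermediateField.adjoin k {g}) x →
      x ∈ (AlgebraicIndependent.matroid k E).closure {g} := by
    intro x hx
    rw [AlgebraicIndependent.matroid_closure_eq]
    rw [SetLike.mem_coe]
    show IsAlgebraic _ _
    exact (IsFractionRing.isAlgebraic_iff (Algebra.adjoin k {g})
      (IntermediateField.adjoin k {g}) E).mpr hx
  have h1 : (AlgebraicIndependent.matroid k E).Indep {a, b} := by
    rw [AlgebraicIndependent.matroid_indep_iff]
    have := hind.coe_range
    rwa [Matrix.range_cons, Matrix.range_cons, Matrix.range_empty, Set.union_empty] at this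
  have hab : a ≠ b := by
    intro h
    have := hind.injective (a₁ := 0) (a₂ := 1) (by simp [h])
    simp at this
  have h2 := h1.encard_le_eRk_of_subset
    (X := (AlgebraicIndependent.matroid k E).closure {g}) (by
      rintro x (rfl | rfl)
      · exact key _ ha
      · exact key _ hb)
  rw [Matroid.eRk_closure_eq, Set.encard_pair hab] at h2
  have h3 := h2.trans (Matroid.eRk_le_encard _ _)
  rw [Set.encard_singleton] at h3
  norm_num at h3

def auxS {E : Type} {l : ℕ} (t : E) (g : Fin l → E) (j : ℕ) : Set E :=
  insert t {x | ∃ i : Fin l, (i : ℕ) < j ∧ x = g i}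

theorem aux_aeval_mem {E : Type} [Field E] [Algebra ℂ E] {σ : Type} (K : IntermediateField ℂ E)
    (v : σ → E) (hv : ∀ i, v i ∈ K) (p : MvPolynomial σ ℂ) : MvPolynomial.aeval v p ∈ K := by
  induction p using MvPolynomial.induction_on with
  | C c => simp
  | add p q hp hq => rw [map_add]; exact add_mem hp hq
  | mul_X p n hp => rw [map_mul, MvPolynomial.aeval_X]; exact mul_mem hp (hv n)

theorem aux_main {E : Type} [Field E] [Algebra ℂ E] (d : Derivation ℂ E E) (t : E) (ht : d t = 1)
    {l : ℕ} (g : Fin l → E)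
    (hg : ∀ i : Fin l, ∃ p : MvPolynomial (Fin ((i : ℕ) + 2)) ℂ, d (g i) =
      MvPolynomial.aeval (Fin.cons t fun j : Fin ((i : ℕ) + 1) => g (Fin.castLE i.isLt j)) p)
    (a : E) (hind : AlgebraicIndependent ℂ ![t, a]) (h : ℕ) (hh : 2 ≤ h)
    (P : MvPolynomial (Fin (h + 2)) ℂ)
    (hP : MvPolynomial.aeval (Fin.cons t fun i : Fin (h + 1) => d^[(i : ℕ)] a) P = 0)
    (hsm : StronglyMinimalODE h P) (j : ℕ) (hj : j ≤ l) :
    ¬ IsAlgebraic (IntermediateField.adjoin ℂ (auxS t g j)) a := by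
  have hcl : ∀ j, ∀ x ∈ IntermediateField.adjoin ℂ (auxS t g j),
      d x ∈ IntermediateField.adjoin ℂ (auxS t g j) := by
    intro j
    apply aux_adjoin_closed
    rintro s (rfl | ⟨i, hi, rfl⟩)
    · rw [ht]; exact one_mem _
    · obtain ⟨p, hp⟩ := hg i
      rw [hp]
      apply aux_aeval_mem
      intro m
      apply IntermediateField.subset_adjoin
      refine Fin.cases ?_ (fun m => ?_) m
      · exact Or.inl rfl
      · refine Or.inr ⟨Fin.castLE i.isLt m, ?_, by simp⟩
        have := m.2
        simp only [Fin.val_castLE]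
        omega
  induction j with
  | zero =>
    intro halg
    have h0 : auxS t g 0 = {t} := by
      ext x; simp [auxS]
    rw [h0] at halg
    refine aux_exchange t t a ?_ halg hind
    exact isAlgebraic_algebraMap
      (⟨t, IntermediateField.subset_adjoin _ _ rfl⟩ : IntermediateField.adjoin ℂ {t})
  | succ j ih =>
    intro halg
    have halg' := aux_deriv_alg d _ (hcl (j + 1)) a halg
    have : CharZero E := charZero_of_injective_algebraMap (algebraMap ℂ E).injective
    rcases hsm E d (fun x y => map_add d x y)
      (fun x y => by rw [Derivation.leibniz, smul_eq_mul, smul_eq_mul, mul_comm y])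
      (IntermediateField.adjoin ℂ (auxS t g j)).toSubfield (hcl j) (algebraMap ℂ E)
      (fun c => (IntermediateField.adjoin ℂ (auxS t g j)).algebraMap_mem c) (by simp) t
      (IntermediateField.subset_adjoin _ _ (Or.inl rfl)) ht a hP with h1 | h1
    · exact ih (by omega) h1
    · have hS : auxS t g (j + 1) = auxS t g j ∪ {g ⟨j, hj⟩} := by
        ext x
        simp only [auxS, Set.mem_insert_iff, Set.mem_ofPred_eq, Set.mem_union,
          Set.mem_singleton_iff, or_assoc]
        refine or_congr_right ⟨?_, ?_⟩
        · rintro ⟨i, hi, rfl⟩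
          by_cases hij : (i : ℕ) = j
          · right; congr 1; exact Fin.ext hij
          · left; exact ⟨i, by omega, rfl⟩
        · rintro (⟨i, hi, rfl⟩ | rfl)
          · exact ⟨i, by omega, rfl⟩
          · exact ⟨⟨j, hj⟩, by simp, rfl⟩
      rw [hS, ← IntermediateField.adjoin_adjoin_left] at halg halg'
      refine aux_exchange (k := IntermediateField.adjoin ℂ (auxS t g j)) (g ⟨j, hj⟩) a (d a)
        halg halg' ?_
      have h2 := h1.comp (fun i : Fin 2 => Fin.castLE hh i) (Fin.castLE_injective hh)
      have e : ![a, d a] = (fun i : Fin h => d^[(i : ℕ)] a) ∘ fun i : Fin 2 => Fin.castLE hh i := by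
        ext i
        fin_cases i <;> simp
      rw [e]
      exact h2

/-- Holomorphic functions on `U`, as functions on the subtype. -/
def auxHol (U : Set ℂ) : Subalgebra ℂ (U → ℂ) where
  carrier := {g | ∃ G : ℂ → ℂ, DifferentiableOn ℂ G U ∧ ∀ z : U, g z = G z}
  mul_mem' := by
    rintro a b ⟨A, hA, ha⟩ ⟨B, hB, hb⟩
    exact ⟨A * B, hA.mul hB, fun z => by simp [ha, hb]⟩
  add_mem' := by
    rintro a b ⟨A, hA, ha⟩ ⟨B, hB, hb⟩
    exact ⟨A + B, hA.add hB, fun z => by simp [ha, hb]⟩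
  algebraMap_mem' c := ⟨fun _ => c, differentiableOn_const c, fun z => rfl⟩

def auxMk {U : Set ℂ} (G : ℂ → ℂ) (hG : DifferentiableOn ℂ G U) : auxHol U :=
  ⟨fun z => G z, G, hG, fun _ => rfl⟩

theorem auxHol_eq_mk {U : Set ℂ} (x : auxHol U) : ∃ G hG, x = auxMk (U := U) G hG := by
  obtain ⟨x, G, hG, h⟩ := x
  exact ⟨G, hG, Subtype.ext (funext h)⟩

noncomputable def auxExt {U : Set ℂ} (x : auxHol U) : ℂ → ℂ := Function.extend Subtype.val x.1 0

theorem auxExt_mk {U : Set ℂ} (G : ℂ → ℂ) (hG : DifferentiableOn ℂ G U) (z : ℂ) (hz : z ∈ U) :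
    auxExt (auxMk G hG) z = G z :=
  Subtype.val_injective.extend_apply (fun z : U => G z) 0 ⟨z, hz⟩

theorem auxExt_deriv {U : Set ℂ} (hU : IsOpen U) (G : ℂ → ℂ) (hG : DifferentiableOn ℂ G U) (z : ℂ)
    (hz : z ∈ U) : deriv (auxExt (auxMk G hG)) z = deriv G z := by
  apply Filter.EventuallyEq.deriv_eq
  filter_upwards [hU.mem_nhds hz] with w hw using auxExt_mk G hG w hw

theorem auxExt_diff {U : Set ℂ} (hU : IsOpen U) (x : auxHol U) :
    DifferentiableOn ℂ (deriv (auxExt x)) U := by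
  obtain ⟨G, hG, rfl⟩ := auxHol_eq_mk x
  exact (hG.deriv hU).congr (fun z hz => auxExt_deriv hU G hG z hz)

noncomputable def auxDfun {U : Set ℂ} (hU : IsOpen U) (x : auxHol U) : auxHol U :=
  auxMk _ (auxExt_diff hU x)

theorem auxDfun_mk {U : Set ℂ} (hU : IsOpen U) (G : ℂ → ℂ) (hG : DifferentiableOn ℂ G U) :
    auxDfun hU (auxMk G hG) = auxMk (deriv G) (hG.deriv hU) :=
  Subtype.ext (funext fun z => auxExt_deriv hU G hG z z.2)

noncomputable def auxD {U : Set ℂ} (hU : IsOpen U) : Derivation ℂ (auxHol U) (auxHol U) :=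
  Derivation.mk'
    { toFun := auxDfun hU
      map_add' := by
        intro x y
        obtain ⟨G, hG, rfl⟩ := auxHol_eq_mk x
        obtain ⟨H, hH, rfl⟩ := auxHol_eq_mk y
        have : auxMk G hG + auxMk H hH = auxMk (U := U) (G + H) (hG.add hH) := rfl
        rw [this, auxDfun_mk, auxDfun_mk, auxDfun_mk]
        refine Subtype.ext (funext fun z => ?_)
        exact deriv_add (hG.differentiableAt (hU.mem_nhds z.2))
          (hH.differentiableAt (hU.mem_nhds z.2))
      map_smul' := by
        intro c x
        obtain ⟨G, hG, rfl⟩ := auxHol_eq_mk x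
        have : c • auxMk G hG = auxMk (U := U) (c • G) (hG.const_smul c) := rfl
        rw [this, auxDfun_mk, auxDfun_mk]
        refine Subtype.ext (funext fun z => ?_)
        exact deriv_const_smul c (hG.differentiableAt (hU.mem_nhds z.2)) }
    (by
      intro x y
      obtain ⟨G, hG, rfl⟩ := auxHol_eq_mk x
      obtain ⟨H, hH, rfl⟩ := auxHol_eq_mk y
      have : auxMk G hG * auxMk H hH = auxMk (U := U) (G * H) (hG.mul hH) := rfl
      show auxDfun hU _ = _ • auxDfun hU _ + _ • auxDfun hU _
      rw [this, auxDfun_mk, auxDfun_mk, auxDfun_mk]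
      refine Subtype.ext (funext fun z => ?_)
      refine (deriv_mul (hG.differentiableAt (hU.mem_nhds z.2))
        (hH.differentiableAt (hU.mem_nhds z.2))).trans ?_
      show _ = G z * deriv H z + H z * deriv G z
      ring)

theorem auxD_mk {U : Set ℂ} (hU : IsOpen U) (G : ℂ → ℂ) (hG : DifferentiableOn ℂ G U) :
    auxD hU (auxMk G hG) = auxMk (deriv G) (hG.deriv hU) := auxDfun_mk hU G hG

theorem auxD_iter {U : Set ℂ} (hU : IsOpen U) (n : ℕ) :
    ∀ (G : ℂ → ℂ) (hG : DifferentiableOn ℂ G U), ∃ h : DifferentiableOn ℂ (deriv^[n] G) U,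
      (auxD hU)^[n] (auxMk G hG) = auxMk (deriv^[n] G) h := by
  induction n with
  | zero => exact fun G hG => ⟨hG, rfl⟩
  | succ n ih =>
    intro G hG
    obtain ⟨h, e⟩ := ih (deriv G) (hG.deriv hU)
    exact ⟨h, by rw [Function.iterate_succ_apply, auxD_mk, e]; rfl⟩

theorem auxHol_domain {U : Set ℂ} (hU : IsOpen U) (hc : IsPreconnected U) (hne : U.Nonempty) :
    IsDomain (auxHol U) := by
  have : Nonempty U := hne.to_subtype
  have : Nontrivial (auxHol U) := inferInstance
  have : NoZeroDivisors (auxHol U) := by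
    constructor
    intro x y hxy
    obtain ⟨G, hG, rfl⟩ := auxHol_eq_mk x
    obtain ⟨H, hH, rfl⟩ := auxHol_eq_mk y
    have := AnalyticOnNhd.eq_zero_or_eq_zero_of_mul_eq_zero (hG.analyticOnNhd hU)
      (hH.analyticOnNhd hU) (fun z hz => congrFun (congrArg Subtype.val hxy) ⟨z, hz⟩) hc
    rcases this with h | h
    · exact Or.inl (Subtype.ext (funext fun z => h z z.2))
    · exact Or.inr (Subtype.ext (funext fun z => h z z.2))
  exact NoZeroDivisors.to_isDomain _

def auxEv {U : Set ℂ} (z : U) : auxHol U →ₐ[ℂ] ℂ := (Pi.evalAlgHom ℂ (fun _ : U => ℂ) z).comp (auxHol U).val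

theorem auxEv_mk {U : Set ℂ} (z : U) (G : ℂ → ℂ) (hG : DifferentiableOn ℂ G U) :
    auxEv z (auxMk G hG) = G z := rfl

theorem auxHol_ext {U : Set ℂ} {x y : auxHol U} (h : ∀ z, auxEv z x = auxEv z y) : x = y :=
  Subtype.ext (funext h)

theorem auxEv_aeval {U : Set ℂ} {σ : Type} (z : U) (v : σ → auxHol U) (w : σ → ℂ)
    (h : ∀ i, auxEv z (v i) = w i) (p : MvPolynomial σ ℂ) :
    auxEv z (MvPolynomial.aeval v p) = MvPolynomial.eval w p := by
  rw [MvPolynomial.comp_aeval_apply, ← MvPolynomial.coe_aeval_eq_eval]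
  have : (fun i => auxEv z (v i)) = w := funext h
  rw [← this]; rfl

theorem aux_lift {A E : Type} [CommRing A] [IsDomain A] [Algebra ℂ A] [Field E] [Algebra ℂ E]
    [Algebra A E] [IsScalarTower ℂ A E] [IsFractionRing A E] (d : Derivation ℂ A A) :
    ∃ d' : Derivation ℂ E E, ∀ x, d' (algebraMap A E x) = algebraMap A E (d x) := by
  have := Algebra.FormallyEtale.of_isLocalization (Rₘ := E) (nonZeroDivisors A)
  have hb := KaehlerDifferential.isBaseChange_of_formallyEtale ℂ A E
  let φ : Ω[A⁄ℂ] →ₗ[A] E := (Algebra.linearMap A E).comp d.liftKaehlerDifferential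
  refine ⟨(hb.lift φ).compDer (KaehlerDifferential.D ℂ E), fun x => ?_⟩
  have h1 := hb.lift_eq φ (KaehlerDifferential.D ℂ A x)
  rw [KaehlerDifferential.map_D] at h1
  show hb.lift φ (KaehlerDifferential.D ℂ E _) = _
  rw [h1]
  simp [φ]

theorem aux_sum {A E : Type} [CommRing A] [Field E] [Algebra ℂ E] (φ : A →+* E)
    (K : IntermediateField ℂ E) {n : ℕ} (b : Fin n → A) (hb : ∀ k, φ (b k) ∈ K) (a : A)
    (hs : ∑ k, b k * a ^ (k : ℕ) = 0) :
    Polynomial.aeval (φ a) (∑ k : Fin n, Polynomial.monomial (k : ℕ) (⟨_, hb k⟩ : K)) = 0 := by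
  rw [map_sum, ← map_zero φ, ← hs, map_sum]
  refine Finset.sum_congr rfl fun k _ => ?_
  rw [Polynomial.aeval_monomial, map_mul, map_pow]
  rfl

theorem aux_first (U : Set ℂ) (hUo : IsOpen U) (hUc : IsPreconnected U) (hne : U.Nonempty)
    (f : ℂ → ℂ) (hf : DifferentiableOn ℂ f U)
    (htr : ¬ ∃ P : MvPolynomial (Fin 2) ℂ, P ≠ 0 ∧
      ∀ z ∈ U, MvPolynomial.eval ![z, f z] P = 0)
    (h : ℕ) (hh : 2 ≤ h)
    (P : MvPolynomial (Fin (h + 2)) ℂ)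
    (hPf : ∀ z ∈ U,
      MvPolynomial.eval (Fin.cons z fun i : Fin (h + 1) => deriv^[(i : ℕ)] f z) P = 0)
    (hsm : StronglyMinimalODE h P) (l : ℕ) (F : Fin l → ℂ → ℂ) (hF : CPfaffianChain U F) :
    ¬ AlgebraicOverCChain U F f := by
  rintro ⟨n, c, ⟨k, hk⟩, hsum⟩
  have := auxHol_domain hUo hUc hne
  let A := auxHol U
  let E := FractionRing A
  obtain ⟨d, hd⟩ := aux_lift (E := E) (auxD hUo)
  have hdi : ∀ (n : ℕ) (x : A), d^[n] (algebraMap A E x) = algebraMap A E ((auxD hUo)^[n] x) := by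
    intro n
    induction n with
    | zero => exact fun x => rfl
    | succ n ih => intro x; rw [Function.iterate_succ_apply, hd, ih]; rfl
  have hinj : Function.Injective (algebraMap A E) := IsFractionRing.injective A E
  let t : A := auxMk id differentiableOn_id
  let a : A := auxMk f hf
  let g : Fin l → A := fun i => auxMk (F i) (hF.1 i)
  -- pushing `aeval` to the fraction field
  have hpush : ∀ {m : ℕ} (x : A) (v : Fin m → A) (p : MvPolynomial (Fin (m + 1)) ℂ),
      MvPolynomial.aeval (Fin.cons (algebraMap A E x) fun i => algebraMap A E (v i)) p =
        algebraMap A E (MvPolynomial.aeval (Fin.cons x v : Fin (m + 1) → A) p) := by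
    intro m x v p
    rw [← MvPolynomial.aeval_algebraMap_apply]
    congr 2
    ext i
    refine Fin.cases ?_ (fun i => ?_) i <;> simp
  have hev : ∀ {m : ℕ} (z : U) (v : Fin m → A) (w : Fin m → ℂ) (_ : ∀ i, auxEv z (v i) = w i)
      (p : MvPolynomial (Fin (m + 1)) ℂ),
      auxEv z (MvPolynomial.aeval (Fin.cons t v : Fin (m + 1) → A) p) =
        MvPolynomial.eval (Fin.cons (z : ℂ) w) p := by
    intro m z v w hvw p
    apply auxEv_aeval
    intro i
    refine Fin.cases ?_ (fun i => ?_) i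
    · rfl
    · simpa using hvw i
  have hmain := aux_main d (algebraMap A E t) (by
      rw [hd, auxD_mk, ← map_one (algebraMap A E)]
      congr 1
      apply auxHol_ext
      intro z
      rw [auxEv_mk, map_one, deriv_id]) (fun i => algebraMap A E (g i)) (by
      intro i
      obtain ⟨p, hp⟩ := hF.2 i
      refine ⟨p, ?_⟩
      rw [hd, hpush, auxD_mk]
      congr 1
      apply auxHol_ext
      intro z
      rw [hev z _ _ (fun i => rfl), auxEv_mk]
      exact hp z z.2) (algebraMap A E a) (by
      rw [algebraicIndependent_iff]
      intro p hp
      by_contra hp0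
      apply htr
      refine ⟨p, hp0, fun z hz => ?_⟩
      have e : ![algebraMap A E t, algebraMap A E a] = fun i => algebraMap A E (![t, a] i) := by
        ext i; fin_cases i <;> rfl
      rw [e] at hp
      have e2 : MvPolynomial.aeval ![t, a] p = 0 := by
        apply hinj
        rw [map_zero, ← hp]
        exact (MvPolynomial.aeval_algebraMap_apply E ![t, a] p).symm
      have e3 := auxEv_aeval (⟨z, hz⟩ : U) ![t, a] ![z, f z] (by
        intro i; fin_cases i <;> rfl) p
      rw [← e3, e2, map_zero]) h hh P (by
      have e : (fun i : Fin (h + 1) => d^[(i : ℕ)] (algebraMap A E a)) =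
          fun i : Fin (h + 1) => algebraMap A E ((auxD hUo)^[(i : ℕ)] a) := funext fun i => hdi _ _
      rw [e, hpush, ← map_zero (algebraMap A E)]
      congr 1
      apply auxHol_ext
      intro z
      rw [hev z _ (fun i : Fin (h + 1) => deriv^[(i : ℕ)] f z) (fun i => by
        obtain ⟨h1, h2⟩ := auxD_iter hUo i f hf
        show auxEv z ((auxD hUo)^[(i : ℕ)] (auxMk f hf)) = _
        rw [h2]; rfl), map_zero]
      exact hPf z z.2) hsm l le_rfl
  apply hmain
  set K := IntermediateField.adjoin ℂ (auxS (algebraMap A E t) (fun i => algebraMap A E (g i)) l)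
    with hK
  let b : Fin (n + 1) → A := fun k => MvPolynomial.aeval (Fin.cons t g : Fin (l + 1) → A) (c k)
  have hbK : ∀ k, algebraMap A E (b k) ∈ K := by
    intro k
    rw [← hpush]
    apply aux_aeval_mem
    intro i
    apply IntermediateField.subset_adjoin
    refine Fin.cases ?_ (fun i => ?_) i
    · exact Or.inl rfl
    · exact Or.inr ⟨i, i.2, by simp⟩
  refine ⟨∑ k : Fin (n + 1), Polynomial.monomial (k : ℕ) (⟨_, hbK k⟩ : K), ?_, ?_⟩
  · intro h0
    apply hk
    intro z hz
    have h1 := congrArg (fun q => Polynomial.coeff q (k : ℕ)) h0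
    simp only [Polynomial.finsetSum_coeff, Polynomial.coeff_monomial, Polynomial.coeff_zero] at h1
    rw [Finset.sum_eq_single k (fun j _ hj => if_neg (fun h => hj (Fin.ext h))) (by simp),
      if_pos rfl] at h1
    have h2 : b k = 0 := by
      apply hinj
      rw [map_zero]
      exact congrArg Subtype.val h1
    rw [← hev ⟨z, hz⟩ g (fun j => F j z) (fun i => rfl) (c k)]
    show auxEv _ (b k) = 0
    rw [h2, map_zero]
  · have : ∑ k, b k * a ^ (k : ℕ) = 0 := by
      apply auxHol_ext
      intro z
      rw [map_zero, map_sum, ← hsum z z.2]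
      refine Finset.sum_congr rfl fun k _ => ?_
      have e1 := hev z g (fun j => F j z) (fun i => rfl) (c k)
      have e2 : auxEv z (b k * a ^ (k : ℕ)) = auxEv z (b k) * auxEv z a ^ (k : ℕ) := by
        rw [map_mul, map_pow]
      exact e2.trans (congrArg (fun x => x * f z ^ (k : ℕ)) e1)
    exact aux_sum (algebraMap A E) K b hbK a this

/-- Let `U ⊆ ℂ` be connected open, `f` holomorphic on `U` and transcendental
over `ℂ(z)`.  If `f` satisfies a strongly minimal algebraic differential equation
`P(z, y, y', …, y⁽ʰ⁾) = 0` of order `h ≥ 2` genuinely involving `Y_h`, then `f` is not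
algebraic over any ℂ-Pfaffian chain on `U`; in particular `f` is not ℂ-Pfaffian on `U`. -/
theorem statement_6 (U : Set ℂ) (hUo : IsOpen U) (hUc : IsPreconnected U)
    (f : ℂ → ℂ) (hf : DifferentiableOn ℂ f U)
    (htr : ¬ ∃ P : MvPolynomial (Fin 2) ℂ, P ≠ 0 ∧
      ∀ z ∈ U, MvPolynomial.eval ![z, f z] P = 0)
    (h : ℕ) (hh : 2 ≤ h)
    (P : MvPolynomial (Fin (h + 2)) ℂ)
    (hPY : Fin.last (h + 1) ∈ P.vars)
    (hPf : ∀ z ∈ U,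
      MvPolynomial.eval (Fin.cons z fun i : Fin (h + 1) => deriv^[(i : ℕ)] f z) P = 0)
    (hsm : StronglyMinimalODE h P) :
    (∀ (l : ℕ) (F : Fin l → ℂ → ℂ), CPfaffianChain U F → ¬ AlgebraicOverCChain U F f) ∧
      ¬ IsCPfaffian U f := by
  have hne : U.Nonempty := by
    by_contra hne
    rw [Set.not_nonempty_iff_eq_empty] at hne
    subst hne
    exact htr ⟨1, one_ne_zero, by simp⟩
  have h1 := aux_first U hUo hUc hne f hf htr h hh P hPf hsm
  refine ⟨h1, ?_⟩
  rintro ⟨l, F, hF, p, hp⟩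
  apply h1 l F hF
  obtain ⟨z₀, hz₀⟩ := hne
  refine ⟨1, ![p, -1], ⟨1, fun H => ?_⟩, fun z hz => ?_⟩
  · simpa using H z₀ hz₀
  · rw [Fin.sum_univ_two]
    simp [hp z hz]
end

section
/- Let V ⊆ ℍ be a connected open set, identified with an open subset of ℝ² via z = x + iy, and let f be holomorphic on V with f′(z) ≠ 0, f(z) ≠ 0 and f(z) ≠ 1728 for all z ∈ V, satisfying on V the j-equation 2·f‴·f′·f²·(f − 1728)² − 3·(f″)²·f²·(f − 1728)² + 2·(f′)⁴·(f² − 1968·f + 2654208) = 0, and suppose f is transcendental over ℂ(z) in 𝓜(V). Then there is no Pfaffian chain (g₁, …, g_l) of real-analytic functions on V such that both Re f and Im f, viewed as real-analytic functions of (x, y) ∈ V, are algebraic over ℝ(x, y, g₁, …, g_l). -/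
/-- `(g 0, …, g (l-1))` is a Pfaffian chain of real-analytic functions on `V ⊆ ℂ ≅ ℝ²`:
each `g i` is real-analytic on `V` and its partial derivatives `∂gᵢ/∂x`, `∂gᵢ/∂y` are
polynomials `pᵢ(x, y, g₁, …, gᵢ)`, `qᵢ(x, y, g₁, …, gᵢ)` with real coefficients. -/
def RPfaffianChain (V : Set ℂ) {l : ℕ} (g : Fin l → ℂ → ℝ) : Prop :=
  (∀ i, AnalyticOnNhd ℝ (g i) V) ∧
  ∀ i : Fin l, ∃ p q : MvPolynomial (Fin ((i : ℕ) + 3)) ℝ,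
    ∀ z ∈ V,
      fderiv ℝ (g i) z 1 =
        MvPolynomial.eval (Fin.cons z.re (Fin.cons z.im
          fun j : Fin ((i : ℕ) + 1) => g (Fin.castLE i.isLt j) z)) p ∧
      fderiv ℝ (g i) z Complex.I =
        MvPolynomial.eval (Fin.cons z.re (Fin.cons z.im
          fun j : Fin ((i : ℕ) + 1) => g (Fin.castLE i.isLt j) z)) q

/-- `u : V → ℝ` is algebraic over the subfield `ℝ(x, y, g₁, …, g_l)` of the field of
fractions of real-analytic functions on `V`: there is a polynomial relation
`∑ₖ cₖ(x, y, g₁, …, g_l) · uᵏ = 0` on `V` with some coefficient not identically zero. -/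
def AlgebraicOverRChain (V : Set ℂ) {l : ℕ} (g : Fin l → ℂ → ℝ) (u : ℂ → ℝ) : Prop :=
  ∃ n : ℕ, ∃ c : Fin (n + 1) → MvPolynomial (Fin (l + 2)) ℝ,
    (∃ k, ¬ ∀ z ∈ V,
      MvPolynomial.eval (Fin.cons z.re (Fin.cons z.im fun j => g j z)) (c k) = 0) ∧
    ∀ z ∈ V, ∑ k : Fin (n + 1),
      MvPolynomial.eval (Fin.cons z.re (Fin.cons z.im fun j => g j z)) (c k) * u z ^ (k : ℕ)
        = 0


open Polynomial in
/-- Any two elements of `L` are algebraically dependent over `K`. -/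
def AlgDep (K L : Type*) [Field K] [Field L] [Algebra K L] : Prop :=
  ∀ a b : L, ∃ G : K[X][X], G ≠ 0 ∧ eval₂ (aeval (R := K) a).toRingHom b G = 0

set_option linter.unusedSectionVars false

section core

open Polynomial

variable {K L : Type*} [Field K] [Field L] [Algebra K L] [CharZero L]

lemma AlgDep.exists_reduced (h : AlgDep K L) (a k : L) (hk : k ≠ 0) :
    ∃ G : K[X][X], G.coeff 0 ≠ 0 ∧ eval₂ (aeval (R := K) a).toRingHom k G = 0 := by
  obtain ⟨G, hG, h0⟩ := h a k
  obtain ⟨n, H, hH, rfl⟩ : ∃ n : ℕ, ∃ H : K[X][X], H.coeff 0 ≠ 0 ∧ G = H * X ^ n := by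
    obtain ⟨H, hH⟩ := Polynomial.exists_eq_pow_rootMultiplicity_mul_and_not_dvd G hG 0
    refine ⟨rootMultiplicity 0 G, H, ?_, ?_⟩
    · intro h
      apply hH.2
      simpa [X_dvd_iff] using h
    · conv_lhs => rw [hH.1]
      simp [mul_comm]
  refine ⟨H, hH, ?_⟩
  rw [eval₂_mul, eval₂_pow, eval₂_X] at h0
  exact (mul_eq_zero.mp h0).resolve_right (pow_ne_zero _ hk)

lemma eval2_split (a k : L) (G : K[X][X]) (A : Subring L) (hKA : ∀ c : K, algebraMap K L c ∈ A)
    (ha : a ∈ A) (hk : k ∈ A) :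
    ∃ b ∈ A, eval₂ (aeval (R := K) a).toRingHom k G = aeval a (G.coeff 0) + k * b := by
  have hpoly : ∀ p : K[X], aeval a p ∈ A := by
    intro p
    induction p using Polynomial.induction_on with
    | C c => simpa using hKA c
    | add p q hp hq => simpa using A.add_mem hp hq
    | monomial n c h => 
      simpa using A.mul_mem (hKA c) (A.pow_mem ha (n+1))
  have hev : ∀ H : K[X][X], eval₂ (aeval (R := K) a).toRingHom k H ∈ A := by
    intro H
    rw [eval₂_eq_sum]
    exact A.sum_mem fun i _ => A.mul_mem (hpoly _) (A.pow_mem hk _)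
  refine ⟨_, hev G.divX, ?_⟩
  conv_lhs => rw [← divX_mul_X_add G]
  rw [eval₂_add, eval₂_mul, eval₂_X, eval₂_C]
  simp only [AlgHom.toRingHom_eq_coe, RingHom.coe_coe]
  ring

lemma val_natCast (O : ValuationSubring L) (hKO : ∀ c : K, algebraMap K L c ∈ O) {n : ℕ}
    (hn : n ≠ 0) : O.valuation (n : L) = 1 := by
  have hn' : (n : L) ≠ 0 := by exact_mod_cast hn
  have h1 : O.valuation (n : L) ≤ 1 := (O.valuation_le_one_iff _).mpr (by simp)
  have h2 : O.valuation ((n : L)⁻¹) ≤ 1 :=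
    (O.valuation_le_one_iff _).mpr (by simpa using hKO (n : K)⁻¹)
  rw [map_inv₀] at h2
  have h3 : 0 < O.valuation (n : L) := by
    rw [zero_lt_iff]; simpa using hn
  exact le_antisymm h1 ((inv_le_one₀ h3).mp h2)

lemma val_eq_one_of (O : ValuationSubring L) {a : L} (ha : a ∈ O) (h : ¬ O.valuation a < 1) :
    O.valuation a = 1 :=
  le_antisymm ((O.valuation_le_one_iff _).mpr ha) (not_lt.mp h)

/-- Derivation estimate, on elements of the maximal ideal. -/
lemma core_max (hdep : AlgDep K L) (O : ValuationSubring L)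
    (hKO : ∀ c : K, algebraMap K L c ∈ O) (E : Derivation ℤ L L)
    (A : Subring L) (hAO : ∀ a ∈ A, a ∈ O) (hKA : ∀ c : K, algebraMap K L c ∈ A)
    (hEA : ∀ a ∈ A, E a ∈ A)
    (k Y : L) (hkA : k ∈ A) (hk0 : k ≠ 0) (hk1 : O.valuation k < 1)
    (hYA : Y ∈ A) (hEk : E k = k * Y)
    (a : L) (ha : a ∈ A) (ha1 : O.valuation a < 1) : O.valuation (E a) < 1 := by
  set v := O.valuation
  have hle : ∀ a ∈ A, v a ≤ 1 := fun a ha => (O.valuation_le_one_iff _).mpr (hAO a ha)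
  by_contra hcon
  have he : v (E a) = 1 := val_eq_one_of O (hAO _ (hEA a ha)) hcon
  have key : ∀ s : ℕ, ¬ ∃ b ∈ A, v b = 1 ∧ ∃ c ∈ A, b * a ^ s = k * c := by
    intro s
    induction s with
    | zero =>
      rintro ⟨b, hb, hb1, c, hc, h⟩
      rw [pow_zero, mul_one] at h
      have : v b < 1 := by
        rw [h, map_mul]
        exact mul_lt_one_of_lt_of_le hk1 (hle c hc)
      exact absurd hb1 this.ne
    | succ s ih =>
      rintro ⟨b, hb, hb1, c, hc, h⟩
      apply ih
      refine ⟨((s + 1 : ℕ) : L) * b ^ 2 * E a, ?_, ?_, b * (Y * c + E c) - E b * c, ?_, ?_⟩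
      · exact A.mul_mem (A.mul_mem (natCast_mem A _) (A.pow_mem hb 2)) (hEA a ha)
      · simp only [map_mul, map_pow, hb1, he]
        rw [val_natCast O hKO (Nat.succ_ne_zero s)]; simp
      · exact A.sub_mem (A.mul_mem hb (A.add_mem (A.mul_mem hYA hc) (hEA c hc)))
          (A.mul_mem (hEA b hb) hc)
      · have h2 := congrArg E h
        simp only [Derivation.leibniz, smul_eq_mul, Derivation.leibniz_pow, hEk, nsmul_eq_mul,
          Nat.add_sub_cancel] at h2
        push_cast at h2 ⊢
        linear_combination b * h2 - E b * h
  obtain ⟨G, hG0, hG⟩ := hdep.exists_reduced a k hk0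
  obtain ⟨b, hb, hbG⟩ := eval2_split a k G A hKA ha hkA
  rw [hG] at hbG
  set g := G.coeff 0
  obtain ⟨n, H, hH, hgH⟩ : ∃ n : ℕ, ∃ H : K[X], H.coeff 0 ≠ 0 ∧ g = H * X ^ n := by
    obtain ⟨H, hH⟩ := Polynomial.exists_eq_pow_rootMultiplicity_mul_and_not_dvd g hG0 0
    refine ⟨rootMultiplicity 0 g, H, ?_, ?_⟩
    · intro h
      apply hH.2
      simpa [X_dvd_iff] using h
    · conv_lhs => rw [hH.1]
      simp [mul_comm]
  have hpoly : ∀ p : K[X], aeval a p ∈ A := by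
    intro p
    induction p using Polynomial.induction_on with
    | C c => simpa using hKA c
    | add p q hp hq => simpa using A.add_mem hp hq
    | monomial n c h => 
      simpa using A.mul_mem (hKA c) (A.pow_mem ha (n+1))
  refine key n ⟨aeval a H, hpoly H, ?_, -b, A.neg_mem hb, ?_⟩
  · have h1 : aeval a H = algebraMap K L (H.coeff 0) + a * aeval a H.divX := by
      conv_lhs => rw [← divX_mul_X_add H]
      simp; ring
    have hc0 : algebraMap K L (H.coeff 0) ≠ 0 := by simpa using hH
    have hc : v (algebraMap K L (H.coeff 0)) = 1 := by
      have h2 : v (algebraMap K L (H.coeff 0)⁻¹) ≤ 1 := (O.valuation_le_one_iff _).mpr (hKO _)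
      rw [map_inv₀, map_inv₀] at h2
      have h3 : 0 < v (algebraMap K L (H.coeff 0)) := by
        rw [zero_lt_iff]; simpa using hH
      exact le_antisymm ((O.valuation_le_one_iff _).mpr (hKO _)) ((inv_le_one₀ h3).mp h2)
    rw [h1, v.map_add_eq_of_lt_left, hc]
    rw [hc, map_mul]
    exact mul_lt_one_of_lt_of_le ha1 (hle _ (hpoly _))
  · have : aeval a g = aeval a H * a ^ n := by rw [hgH]; simp
    rw [← this]; linear_combination -hbG

/-- Derivation estimate: `E` vanishes on the residue ring. -/
lemma core_all (hdep : AlgDep K L) (O : ValuationSubring L)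
    (hKO : ∀ c : K, algebraMap K L c ∈ O) (E : Derivation ℤ L L)
    (A : Subring L) (hAO : ∀ a ∈ A, a ∈ O) (hKA : ∀ c : K, algebraMap K L c ∈ A)
    (hEA : ∀ a ∈ A, E a ∈ A)
    (k Y : L) (hkA : k ∈ A) (hk0 : k ≠ 0) (hk1 : O.valuation k < 1)
    (hYA : Y ∈ A) (hEk : E k = k * Y)
    (hEK : ∀ c : K, ∃ b ∈ A, E (algebraMap K L c) = k * b)
    (a : L) (ha : a ∈ A) : O.valuation (E a) < 1 := by
  set v := O.valuation with hv
  have hle : ∀ a ∈ A, v a ≤ 1 := fun a ha => (O.valuation_le_one_iff _).mpr (hAO a ha)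
  have hpoly : ∀ p : K[X], aeval a p ∈ A := by
    intro p
    induction p using Polynomial.induction_on with
    | C c => simpa using hKA c
    | add p q hp hq => simpa using A.add_mem hp hq
    | monomial n c h => 
      simpa using A.mul_mem (hKA c) (A.pow_mem ha (n+1))
  have hEp : ∀ p : K[X], ∃ b ∈ A, E (aeval a p) = k * b + aeval a (derivative p) * E a := by
    intro p
    induction p using Polynomial.induction_on' with
    | add p q hp hq =>
      obtain ⟨b, hb, h⟩ := hp
      obtain ⟨b', hb', h'⟩ := hq
      refine ⟨b + b', A.add_mem hb hb', ?_⟩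
      simp only [map_add, h, h']; ring
    | monomial n c =>
      obtain ⟨b, hb, h⟩ := hEK c
      refine ⟨b * a ^ n, A.mul_mem hb (A.pow_mem ha _), ?_⟩
      simp only [aeval_monomial, Derivation.leibniz, h, Derivation.leibniz_pow, smul_eq_mul,
        derivative_monomial, nsmul_eq_mul, map_mul, map_natCast]
      ring
  have hex : ∃ n : ℕ, ∃ p : K[X], p ≠ 0 ∧ p.natDegree = n ∧ v (aeval a p) < 1 := by
    obtain ⟨G, hG0, hG⟩ := hdep.exists_reduced a k hk0
    obtain ⟨b, hb, hbG⟩ := eval2_split a k G A hKA ha hkA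
    rw [hG] at hbG
    refine ⟨_, G.coeff 0, hG0, rfl, ?_⟩
    have : aeval a (G.coeff 0) = -(k * b) := by linear_combination -hbG
    rw [this, Valuation.map_neg, map_mul]
    exact mul_lt_one_of_lt_of_le hk1 (hle b hb)
  classical
  obtain ⟨p, hp0, hpn, hp1⟩ := Nat.find_spec hex
  have hmin := fun m => @Nat.find_min _ _ hex m
  rw [← hpn] at hmin
  have hdeg : p.natDegree ≠ 0 := by
    intro h0
    obtain ⟨c, rfl⟩ := natDegree_eq_zero.mp h0
    have hc0 : c ≠ 0 := by rintro rfl; simp at hp0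
    have h2 : v (algebraMap K L c⁻¹) ≤ 1 := (O.valuation_le_one_iff _).mpr (hKO _)
    have h3 : v (algebraMap K L c) < 1 := by simpa using hp1
    have h4 : v (algebraMap K L c * algebraMap K L c⁻¹) < 1 := by
      rw [map_mul]; exact mul_lt_one_of_lt_of_le h3 h2
    rw [← map_mul, mul_inv_cancel₀ hc0] at h4
    simp at h4
  have : CharZero K := ⟨fun a b hab => by
    have := congrArg (algebraMap K L) hab
    simpa using this⟩
  have hd : v (aeval a (derivative p)) = 1 := by
    apply val_eq_one_of O (hAO _ (hpoly _))
    intro hlt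
    refine hmin _ (natDegree_derivative_lt hdeg) ⟨derivative p, ?_, rfl, hlt⟩
    intro h
    exact hdeg (derivative_eq_zero.mp h)
  obtain ⟨b, hb, h⟩ := hEp p
  have h5 := core_max hdep O hKO E A hAO hKA hEA k Y hkA hk0 hk1 hYA hEk _ (hpoly p) hp1
  have h6 : v (aeval a (derivative p) * E a) < 1 := by
    have : aeval a (derivative p) * E a = E (aeval a p) - k * b := by rw [h]; ring
    rw [this]
    refine v.map_sub_lt h5 ?_
    rw [map_mul]
    exact mul_lt_one_of_lt_of_le hk1 (hle b hb)
  rwa [map_mul, hd, one_mul] at h6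

lemma closure_stable (E : Derivation ℤ L L) (S : Set L)
    (h : ∀ s ∈ S, E s ∈ Subring.closure S) : ∀ a ∈ Subring.closure S, E a ∈ Subring.closure S := by
  intro a ha
  induction ha using Subring.closure_induction with
  | mem x hx => exact h x hx
  | zero => simp
  | one => simp
  | add x y hx hy h1 h2 => rw [map_add]; exact Subring.add_mem _ h1 h2
  | neg x hx h1 => rw [map_neg]; exact Subring.neg_mem _ h1
  | mul x y hx hy h1 h2 =>
    rw [Derivation.leibniz]
    exact Subring.add_mem _ (Subring.mul_mem _ hx h2) (Subring.mul_mem _ hy h1)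

/-- Commensurability of valuations of algebraically dependent elements. -/
lemma exists_commens (hdep : AlgDep K L) (O : ValuationSubring L)
    (hKO : ∀ c : K, algebraMap K L c ∈ O) (x k : L) (hx0 : x ≠ 0) (hk0 : k ≠ 0)
    (hx1 : O.valuation x < 1) (hk1 : O.valuation k < 1) :
    ∃ m n : ℕ, 0 < m ∧ 0 < n ∧ O.valuation x ^ m = O.valuation k ^ n := by
  set v := O.valuation with hv
  obtain ⟨G, hG, h0⟩ := hdep x k
  have hvc : ∀ c : K, c ≠ 0 → v (algebraMap K L c) = 1 := by
    intro c hc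
    have h2 : v (algebraMap K L c⁻¹) ≤ 1 := (O.valuation_le_one_iff _).mpr (hKO _)
    rw [map_inv₀, map_inv₀] at h2
    have h3 : 0 < v (algebraMap K L c) := by
      rw [zero_lt_iff]; simpa using hc
    exact le_antisymm ((O.valuation_le_one_iff _).mpr (hKO _)) ((inv_le_one₀ h3).mp h2)
  have hvx : v x ≠ 0 := by simpa using hx0
  have hvk : v k ≠ 0 := by simpa using hk0
  by_contra hcon
  push Not at hcon
  -- the monomials have different valuations
  have hinj : ∀ i j i' j' : ℕ, v x ^ i * v k ^ j = v x ^ i' * v k ^ j' → i = i' ∧ j = j' := by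
    have aux : ∀ i j i' j' : ℕ, i ≤ i' → v x ^ i * v k ^ j = v x ^ i' * v k ^ j' →
        i = i' ∧ j = j' := by
      intro i j i' j' hii h
      obtain ⟨d, rfl⟩ := Nat.exists_eq_add_of_le hii
      have h1 : v k ^ j = v x ^ d * v k ^ j' := by
        rw [pow_add, mul_assoc] at h
        exact mul_left_cancel₀ (pow_ne_zero _ hvx) h
      rcases le_or_gt j j' with hj | hj
      · obtain ⟨e, rfl⟩ := Nat.exists_eq_add_of_le hj
        have h2 : v x ^ d * v k ^ e = 1 := by
          have : v k ^ j * (v x ^ d * v k ^ e) = v k ^ j * 1 := by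
            rw [mul_one]; conv_rhs => rw [h1]
            rw [pow_add]; ac_rfl
          exact mul_left_cancel₀ (pow_ne_zero _ hvk) this
        have hd : d = 0 := by
          by_contra hd
          exact absurd h2 (mul_lt_one_of_lt_of_le (pow_lt_one₀ zero_le hx1 hd)
            (pow_le_one₀ zero_le hk1.le)).ne
        have he : e = 0 := by
          by_contra he
          exact absurd h2 (mul_comm (v x ^ d) (v k ^ e) ▸ mul_lt_one_of_lt_of_le
            (pow_lt_one₀ zero_le hk1 he) (pow_le_one₀ zero_le hx1.le)).ne
        omega
      · obtain ⟨e, rfl⟩ := Nat.exists_eq_add_of_le hj.le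
        have h2 : v k ^ e = v x ^ d := by
          rw [pow_add, mul_comm] at h1
          exact mul_right_cancel₀ (pow_ne_zero _ hvk) h1
        have he : 0 < e := by omega
        rcases Nat.eq_zero_or_pos d with hd | hd
        · subst hd
          exact absurd h2 (by rw [pow_zero]; exact (pow_lt_one₀ zero_le hk1 he.ne').ne)
        · exact absurd h2.symm (hcon d e hd he)
    intro i j i' j' h
    rcases le_total i i' with hi | hi
    · exact aux _ _ _ _ hi h
    · have := aux _ _ _ _ hi h.symm
      exact ⟨this.1.symm, this.2.symm⟩
  -- expand
  let s : Finset (ℕ × ℕ) := (G.support.sigma fun j => (G.coeff j).support).image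
    fun p => (p.2, p.1)
  have hs : ∀ p : ℕ × ℕ, p ∈ s ↔ (G.coeff p.2).coeff p.1 ≠ 0 := by
    rintro ⟨i, j⟩
    simp only [s, Finset.mem_image, Finset.mem_sigma, mem_support_iff, Sigma.exists, Prod.mk.injEq]
    constructor
    · rintro ⟨a, b, ⟨-, h⟩, rfl, rfl⟩
      exact h
    · intro h
      exact ⟨j, i, ⟨fun h' => h (by simp [h']), h⟩, rfl, rfl⟩
  have hsum : ∑ p ∈ s, algebraMap K L ((G.coeff p.2).coeff p.1) * x ^ p.1 * k ^ p.2 = 0 := by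
    rw [← h0, eval₂_eq_sum, Polynomial.sum, Finset.sum_image, Finset.sum_sigma]
    · refine Finset.sum_congr rfl fun j _ => ?_
      simp only [AlgHom.toRingHom_eq_coe, RingHom.coe_coe]
      rw [aeval_def, eval₂_eq_sum, Polynomial.sum, Finset.sum_mul]
    · rintro ⟨a, b⟩ - ⟨c, d⟩ - h
      simp only [Prod.mk.injEq] at h
      obtain ⟨rfl, rfl⟩ := h
      rfl
  have hne : s.Nonempty := by
    obtain ⟨j, hj⟩ := Polynomial.support_nonempty.mpr hG
    rw [mem_support_iff] at hj
    obtain ⟨i, hi⟩ := Polynomial.support_nonempty.mpr hj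
    exact ⟨(i, j), (hs _).mpr (mem_support_iff.mp hi)⟩
  have hval : ∀ p ∈ s, v (algebraMap K L ((G.coeff p.2).coeff p.1) * x ^ p.1 * k ^ p.2)
      = v x ^ p.1 * v k ^ p.2 := by
    intro p hp
    rw [map_mul, map_mul, map_pow, map_pow, hvc _ ((hs p).mp hp), one_mul]
  obtain ⟨q, hq, hmax⟩ := Finset.exists_max_image s (fun p => v x ^ p.1 * v k ^ p.2) hne
  have := v.map_sum_eq_of_lt
    (f := fun p : ℕ × ℕ => algebraMap K L ((G.coeff p.2).coeff p.1) * x ^ p.1 * k ^ p.2) hq (by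
    intro p hp
    rw [Finset.mem_sdiff, Finset.mem_singleton] at hp
    rw [hval p hp.1, hval q hq]
    refine lt_of_le_of_ne (hmax p hp.1) fun h => hp.2 ?_
    have := hinj _ _ _ _ h
    exact Prod.ext this.1 this.2)
  rw [hsum, hval q hq, map_zero] at this
  exact mul_ne_zero (pow_ne_zero _ hvx) (pow_ne_zero _ hvk) this.symm

/-- Rationality of ratios of logarithmic derivatives. -/
lemma core_ratio (hdep : AlgDep K L) (O : ValuationSubring L)
    (hKO : ∀ c : K, algebraMap K L c ∈ O) (E : Derivation ℤ L L)
    (A : Subring L) (hAO : ∀ a ∈ A, a ∈ O) (hKA : ∀ c : K, algebraMap K L c ∈ A)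
    (hEA : ∀ a ∈ A, E a ∈ A)
    (k Y : L) (hkA : k ∈ A) (hk0 : k ≠ 0) (hk1 : O.valuation k < 1)
    (hYA : Y ∈ A) (hEk : E k = k * Y)
    (hEK : ∀ c : K, ∃ b ∈ A, E (algebraMap K L c) = k * b)
    (x W : L) (hx0 : x ≠ 0) (hx1 : O.valuation x < 1)
    (hWA : W ∈ A) (hEx : E x = x * W) :
    ∃ m n : ℕ, 0 < m ∧ 0 < n ∧ O.valuation (m * W - n * Y) < 1 := by
  obtain ⟨m, n, hm, hn, hmn⟩ := exists_commens hdep O hKO x k hx0 hk0 hx1 hk1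
  refine ⟨m, n, hm, hn, ?_⟩
  set u := x ^ m / k ^ n with hu
  have hu0 : u ≠ 0 := div_ne_zero (pow_ne_zero _ hx0) (pow_ne_zero _ hk0)
  have hk0' : O.valuation k ≠ 0 := by simpa using hk0
  have hvu : O.valuation u = 1 := by
    rw [hu, map_div₀, map_pow, map_pow, hmn, div_self (pow_ne_zero _ hk0')]
  have hxm : E (x ^ m) = x ^ m * (m * W) := by
    obtain ⟨m, rfl⟩ := Nat.exists_eq_succ_of_ne_zero hm.ne'
    rw [Derivation.leibniz_pow, hEx]; simp [pow_succ]; ring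
  have hkn : E (k ^ n) = k ^ n * (n * Y) := by
    obtain ⟨n, rfl⟩ := Nat.exists_eq_succ_of_ne_zero hn.ne'
    rw [Derivation.leibniz_pow, hEk]; simp [pow_succ]; ring
  have hEu : E u = u * (m * W - n * Y) := by
    have h1 : u * k ^ n = x ^ m := by rw [hu]; field_simp
    have h2 := congrArg E h1
    rw [Derivation.leibniz, hxm, hkn, ← h1] at h2
    simp only [smul_eq_mul] at h2
    have : k ^ n * E u = k ^ n * (u * (m * W - n * Y)) := by linear_combination h2
    exact mul_left_cancel₀ (pow_ne_zero _ hk0) this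
  have hEui : E u⁻¹ = u⁻¹ * -(m * W - n * Y) := by
    rw [Derivation.leibniz_inv, hEu]
    simp only [smul_eq_mul]; field_simp
  let S : Set L := (A : Set L) ∪ {u, u⁻¹}
  have hAS : ∀ a ∈ A, a ∈ Subring.closure S := fun a ha => Subring.subset_closure (Or.inl ha)
  have huS : u ∈ Subring.closure S := Subring.subset_closure (Or.inr (by simp))
  have huiS : u⁻¹ ∈ Subring.closure S := Subring.subset_closure (Or.inr (by simp))
  have hZ : (m * W - n * Y) ∈ A :=
    A.sub_mem (A.mul_mem (natCast_mem A _) hWA) (A.mul_mem (natCast_mem A _) hYA)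
  have hst := closure_stable E S (by
    rintro s (hs | hs)
    · exact hAS _ (hEA s hs)
    · rcases hs with rfl | hs
      · rw [hEu]; exact Subring.mul_mem _ huS (hAS _ hZ)
      · rw [Set.mem_singleton_iff] at hs
        rw [hs, hEui]
        exact Subring.mul_mem _ huiS (Subring.neg_mem _ (hAS _ hZ)))
  have hSO : ∀ a ∈ Subring.closure S, a ∈ O := by
    have : Subring.closure S ≤ O.toSubring := by
      rw [Subring.closure_le]
      rintro s (hs | hs)
      · exact hAO s hs
      · rcases hs with rfl | hs
        · exact (O.valuation_le_one_iff _).mp hvu.le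
        · rw [Set.mem_singleton_iff] at hs
          rw [hs]
          refine (O.valuation_le_one_iff _).mp ?_
          rw [map_inv₀, hvu]; simp
    exact fun a ha => this ha
  have := core_all hdep O hKO E (Subring.closure S) hSO (fun c => hAS _ (hKA c)) hst k Y
    (hAS _ hkA) hk0 hk1 (hAS _ hYA) hEk
    (fun c => by obtain ⟨b, hb, h⟩ := hEK c; exact ⟨b, hAS _ hb, h⟩) u huS
  rwa [hEu, map_mul, hvu, one_mul] at this

end core

section places

set_option linter.unusedSectionVars false

open Polynomial

variable {K L : Type*} [Field K] [Field L] [Algebra K L] [CharZero L]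

/-- The subring generated by `K` and `T`. -/
def genRing (K : Type*) {L : Type*} [Field K] [Field L] [Algebra K L] (T : Set L) : Subring L :=
  Subring.closure (Set.range (algebraMap K L) ∪ T)

lemma genRing_K (T : Set L) (c : K) : algebraMap K L c ∈ genRing K T :=
  Subring.subset_closure (Or.inl ⟨c, rfl⟩)

lemma genRing_T (T : Set L) {t : L} (ht : t ∈ T) : t ∈ genRing K T :=
  Subring.subset_closure (Or.inr ht)

lemma genRing_half (T : Set L) : (1 / 2 : L) ∈ genRing K T := by
  have := genRing_K T (1 / 2 : K)
  rwa [map_div₀, map_one, map_ofNat] at this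

lemma D_ofNat (D : Derivation ℤ L L) (n : ℕ) [n.AtLeastTwo] : D (OfNat.ofNat n : L) = 0 :=
  D.map_natCast n

lemma core_gen (hdep : AlgDep K L) (O : ValuationSubring L)
    (hKO : ∀ c : K, algebraMap K L c ∈ O) (E : Derivation ℤ L L)
    (T : Set L) (hTO : ∀ t ∈ T, t ∈ O) (hT : ∀ t ∈ T, E t ∈ genRing K T)
    (k Y : L) (hkA : k ∈ genRing K T) (hk0 : k ≠ 0) (hk1 : O.valuation k < 1)
    (hYA : Y ∈ genRing K T) (hEk : E k = k * Y)
    (hEK : ∀ c : K, ∃ b ∈ genRing K T, E (algebraMap K L c) = k * b) :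
    (∀ a ∈ genRing K T, O.valuation (E a) < 1) ∧
    ∀ x W : L, x ≠ 0 → O.valuation x < 1 → W ∈ genRing K T → E x = x * W →
    ∃ m n : ℕ, 0 < m ∧ 0 < n ∧ O.valuation (m * W - n * Y) < 1 := by
  have hAO : ∀ a ∈ genRing K T, a ∈ O := by
    have : genRing K T ≤ O.toSubring := by
      rw [genRing, Subring.closure_le]
      rintro s (⟨c, rfl⟩ | hs)
      · exact hKO c
      · exact hTO s hs
    exact fun a ha => this ha
  have hst : ∀ a ∈ genRing K T, E a ∈ genRing K T := by
    apply closure_stable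
    rintro s (⟨c, rfl⟩ | hs)
    · obtain ⟨b, hb, h⟩ := hEK c
      rw [h]
      exact Subring.mul_mem _ hkA hb
    · exact hT s hs
  refine ⟨fun a ha => core_all hdep O hKO E _ hAO (genRing_K T) hst k Y hkA hk0 hk1 hYA hEk hEK a ha,
    fun x W hx0 hx1 hW hEx => core_ratio hdep O hKO E _ hAO (genRing_K T) hst k Y hkA hk0 hk1 hYA
      hEk hEK x W hx0 hx1 hW hEx⟩

/-- An integer in the maximal ideal is zero. -/
lemma natCast_not_lt (O : ValuationSubring L) (hKO : ∀ c : K, algebraMap K L c ∈ O) {n : ℕ}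
    (hn : n ≠ 0) (h : O.valuation (n : L) < 1) : False := by
  rw [val_natCast O hKO hn] at h
  exact lt_irrefl _ h

lemma mem_nonunits_mul (O : ValuationSubring L) {a b : L} (ha : O.valuation a < 1) (hb : b ∈ O) :
    O.valuation (b * a) < 1 := by
  rw [mul_comm, map_mul]
  exact mul_lt_one_of_lt_of_le ha ((O.valuation_le_one_iff _).mpr hb)

lemma inv_small (O : ValuationSubring L) {a : L} (ha : a ∉ O) : O.valuation a⁻¹ < 1 := by
  have h1 : 1 < O.valuation a := by
    rw [← not_le, O.valuation_le_one_iff]; exact ha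
  rw [map_inv₀]
  exact inv_lt_one_of_one_lt₀ h1

lemma mem_of_small (O : ValuationSubring L) {a : L} (ha : O.valuation a < 1) : a ∈ O :=
  (O.valuation_le_one_iff _).mp ha.le

lemma place_finite (D : Derivation ℤ L L) (hDK : ∀ c : K, ∃ c' : K, D (algebraMap K L c) = algebraMap K L c')
  (hdep : AlgDep K L) (O : ValuationSubring L) (hKO : ∀ c : K, algebraMap K L c ∈ O)
  (f h η : L) (hh : h ≠ 0) (hDf : D f = h * (f * (f - 1728)))
  (hDh : D h = h ^ 2 * η)
  (hDη : D η = h * (-(f ^ 2 - 1968 * f + 1161216) - η ^ 2 / 2))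
    (hf0 : f ≠ 0) (hf1 : f - 1728 ≠ 0) (hfO : f ∈ O) : h ∈ O := by
  by_contra hhO
  set v := O.valuation with hv
  have hk1 : v h⁻¹ < 1 := inv_small O hhO
  have hk0 : h⁻¹ ≠ 0 := inv_ne_zero hh
  set k := h⁻¹ with hk
  have hkh : k * h = 1 := inv_mul_cancel₀ hh
  have hDk : D k = - η := by
    rw [hk, Derivation.leibniz_inv, hDh]
    simp only [smul_eq_mul]; field_simp
  have hnum : ∀ n : ℕ, (n : L) ∈ O := fun n => natCast_mem O n
  by_cases hηO : η ∈ O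
  · let T : Set L := {f, k, η}
    have hfT : f ∈ genRing K T := genRing_T T (by simp [T])
    have hkT : k ∈ genRing K T := genRing_T T (by simp [T])
    have hηT : η ∈ genRing K T := genRing_T T (by simp [T])
    have hEf : (k • D) f = f * (f - 1728) := by
      rw [Derivation.smul_apply, hDf, smul_eq_mul]; linear_combination f * (f - 1728) * hkh
    have hEk : (k • D) k = k * (-η) := by
      rw [Derivation.smul_apply, hDk, smul_eq_mul]
    have hEη : (k • D) η = -(f ^ 2 - 1968 * f + 1161216) - η ^ 2 * (1 / 2) := by
      rw [Derivation.smul_apply, hDη, smul_eq_mul]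
      linear_combination (-(f ^ 2 - 1968 * f + 1161216) - η ^ 2 * (1 / 2)) * hkh
    have hf' : f - 1728 ∈ genRing K T := Subring.sub_mem _ hfT (ofNat_mem _ 1728)
    have hQT : -(f ^ 2 - 1968 * f + 1161216) - η ^ 2 * (1 / 2) ∈ genRing K T := 
      Subring.sub_mem _ (Subring.neg_mem _ (Subring.add_mem _ (Subring.sub_mem _
        (Subring.pow_mem _ hfT 2) (Subring.mul_mem _ (ofNat_mem _ 1968) hfT)) (ofNat_mem _ 1161216)))
        (Subring.mul_mem _ (Subring.pow_mem _ hηT 2) (genRing_half T))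
    obtain ⟨h1, h2⟩ := core_gen hdep O hKO (k • D) T
      (by
        rintro t (rfl | rfl | rfl)
        exacts [hfO, mem_of_small O hk1, hηO])
      (by
        rintro t (rfl | rfl | rfl)
        · rw [hEf]; exact Subring.mul_mem _ hfT hf'
        · rw [hEk]; exact Subring.mul_mem _ hkT (Subring.neg_mem _ hηT)
        · rw [hEη]; exact hQT)
      k (-η) hkT hk0 hk1 (Subring.neg_mem _ hηT) hEk
      (by
        intro c
        obtain ⟨c', hc'⟩ := hDK c
        exact ⟨_, genRing_K T c', by rw [Derivation.smul_apply, hc', smul_eq_mul]⟩)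
    have h3 := h1 f hfT
    have h4 := h1 η hηT
    rw [hEf, map_mul] at h3
    rw [hEη] at h4
    rcases lt_or_ge (v f) 1 with hf | hf
    · obtain ⟨m, n, hm, hn, hmn⟩ := h2 f (f - 1728) hf0 hf hf' hEf
      refine natCast_not_lt O hKO (n := 2322432 * n ^ 2 + 2985984 * m ^ 2) (by positivity) ?_
      have : ((2322432 * n ^ 2 + 2985984 * m ^ 2 : ℕ) : L) =
          -(2 * n ^ 2) * (-(f ^ 2 - 1968 * f + 1161216) - η ^ 2 * (1 / 2))
          + -(n * η - (m * (f - 1728))) * (m * (f - 1728) - n * (-η))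
          + (m ^ 2 * (-f + 3456) - 2 * n ^ 2 * (f - 1968)) * f := by
        push_cast; ring
      rw [this]
      have hmO := hnum m
      have hnO := hnum n
      have hN : ∀ n : ℕ, [n.AtLeastTwo] → (OfNat.ofNat n : L) ∈ O := fun n _ => ofNat_mem O n
      refine v.map_add_lt (v.map_add_lt (mem_nonunits_mul O h4 ?_) (mem_nonunits_mul O hmn ?_))
        (mem_nonunits_mul O hf ?_)
      · exact neg_mem (mul_mem (hN 2) (pow_mem hnO 2))
      · exact neg_mem (sub_mem (mul_mem hnO hηO) (mul_mem hmO (sub_mem hfO (hN 1728))))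
      · exact sub_mem (mul_mem (pow_mem hmO 2) (add_mem (neg_mem hfO) (hN 3456)))
          (mul_mem (mul_mem (hN 2) (pow_mem hnO 2)) (sub_mem hfO (hN 1968)))
    · have hf : v (f - 1728) < 1 := by
        have hf1 : v f = 1 := le_antisymm ((O.valuation_le_one_iff _).mpr hfO) hf
        rwa [← hv, hf1, one_mul] at h3
      obtain ⟨m, n, hm, hn, hmn⟩ := h2 (f - 1728) f hf1 hf hfT (by
        rw [map_sub, hEf, D_ofNat]; ring)
      refine natCast_not_lt O hKO (n := 1492992 * n ^ 2 + 2985984 * m ^ 2) (by positivity) ?_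
      have : ((1492992 * n ^ 2 + 2985984 * m ^ 2 : ℕ) : L) =
          -(2 * n ^ 2) * (-(f ^ 2 - 1968 * f + 1161216) - η ^ 2 * (1 / 2))
          + -(n * η - (m * f)) * (m * f - n * (-η))
          + (-(m ^ 2 * (f + 1728)) - 2 * n ^ 2 * (f - 240)) * (f - 1728) := by
        push_cast; ring
      rw [this]
      have hmO := hnum m
      have hnO := hnum n
      have hN : ∀ n : ℕ, [n.AtLeastTwo] → (OfNat.ofNat n : L) ∈ O := fun n _ => ofNat_mem O n
      refine v.map_add_lt (v.map_add_lt (mem_nonunits_mul O h4 ?_) (mem_nonunits_mul O hmn ?_))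
        (mem_nonunits_mul O hf ?_)
      · exact neg_mem (mul_mem (hN 2) (pow_mem hnO 2))
      · exact neg_mem (sub_mem (mul_mem hnO hηO) (mul_mem hmO hfO))
      · exact sub_mem (neg_mem (mul_mem (pow_mem hmO 2) (add_mem hfO (hN 1728))))
          (mul_mem (mul_mem (hN 2) (pow_mem hnO 2)) (sub_mem hfO (hN 240)))
  · have hη0 : η ≠ 0 := by rintro rfl; exact hηO (zero_mem O)
    have hz1 : v η⁻¹ < 1 := inv_small O hηO
    have hz0 : η⁻¹ ≠ 0 := inv_ne_zero hη0
    have hzη : η⁻¹ * η = 1 := inv_mul_cancel₀ hη0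
    have hDz : D η⁻¹ = h * (1 / 2 + (f ^ 2 - 1968 * f + 1161216) * η⁻¹ ^ 2) := by
      rw [Derivation.leibniz_inv, hDη]
      simp only [smul_eq_mul]; field_simp; ring
    set z := η⁻¹ with hz
    let T : Set L := {f, k, z}
    have hfT : f ∈ genRing K T := genRing_T T (by simp [T])
    have hkT : k ∈ genRing K T := genRing_T T (by simp [T])
    have hzT : z ∈ genRing K T := genRing_T T (by simp [T])
    have hEf : ((z * k) • D) f = z * (f * (f - 1728)) := by
      rw [Derivation.smul_apply, hDf, smul_eq_mul]
      linear_combination z * f * (f - 1728) * hkh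
    have hEk : ((z * k) • D) k = k * (-1) := by
      rw [Derivation.smul_apply, hDk, smul_eq_mul]
      linear_combination -k * hzη
    have hEz : ((z * k) • D) z = z * (1 / 2 + (f ^ 2 - 1968 * f + 1161216) * z ^ 2) := by
      rw [Derivation.smul_apply, hDz, smul_eq_mul]
      linear_combination z * (1 / 2 + (f ^ 2 - 1968 * f + 1161216) * z ^ 2) * hkh
    have hf' : f - 1728 ∈ genRing K T := Subring.sub_mem _ hfT (ofNat_mem _ 1728)
    have hQT : (1 / 2 + (f ^ 2 - 1968 * f + 1161216) * z ^ 2) ∈ genRing K T := 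
      Subring.add_mem _ (genRing_half T) (Subring.mul_mem _ (Subring.add_mem _ (Subring.sub_mem _
        (Subring.pow_mem _ hfT 2) (Subring.mul_mem _ (ofNat_mem _ 1968) hfT)) (ofNat_mem _ 1161216))
        (Subring.pow_mem _ hzT 2))
    have h1T : (-1 : L) ∈ genRing K T := Subring.neg_mem _ (Subring.one_mem _)
    obtain ⟨-, h2⟩ := core_gen hdep O hKO ((z * k) • D) T
      (by
        rintro t (rfl | rfl | rfl)
        exacts [hfO, mem_of_small O hk1, mem_of_small O hz1])
      (by
        rintro t (rfl | rfl | rfl)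
        · rw [hEf]; exact Subring.mul_mem _ hzT (Subring.mul_mem _ hfT hf')
        · rw [hEk]; exact Subring.mul_mem _ hkT h1T
        · rw [hEz]; exact Subring.mul_mem _ hzT hQT)
      k (-1) hkT hk0 hk1 h1T hEk
      (by
        intro c
        obtain ⟨c', hc'⟩ := hDK c
        exact ⟨z * algebraMap K L c', Subring.mul_mem _ hzT (genRing_K T c'), by
          rw [Derivation.smul_apply, hc', smul_eq_mul]; ring⟩)
    obtain ⟨m, n, hm, hn, hmn⟩ := h2 z _ hz0 hz1 hQT hEz
    refine natCast_not_lt O hKO (n := m + 2 * n) (by positivity) ?_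
    have : ((m + 2 * n : ℕ) : L) =
        2 * (m * (1 / 2 + (f ^ 2 - 1968 * f + 1161216) * z ^ 2) - n * (-1))
        + (-(2 * m * (f ^ 2 - 1968 * f + 1161216)) * z) * z := by
      push_cast; ring
    rw [this]
    have hmO := hnum m
    have hN : ∀ n : ℕ, [n.AtLeastTwo] → (OfNat.ofNat n : L) ∈ O := fun n _ => ofNat_mem O n
    refine v.map_add_lt (mem_nonunits_mul O hmn (hN 2)) (mem_nonunits_mul O hz1 ?_)
    exact mul_mem (neg_mem (mul_mem (mul_mem (hN 2) hmO) (add_mem (sub_mem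
      (pow_mem hfO 2) (mul_mem (hN 1968) hfO)) (hN 1161216)))) (mem_of_small O hz1)

lemma place_infinite (D : Derivation ℤ L L) (hDK : ∀ c : K, ∃ c' : K, D (algebraMap K L c) = algebraMap K L c')
  (hdep : AlgDep K L) (O : ValuationSubring L) (hKO : ∀ c : K, algebraMap K L c ∈ O)
  (f h η : L) (hh : h ≠ 0) (hDf : D f = h * (f * (f - 1728)))
  (hDh : D h = h ^ 2 * η)
  (hDη : D η = h * (-(f ^ 2 - 1968 * f + 1161216) - η ^ 2 / 2))
    (hfO : f ∉ O) : h * f ∈ O := by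
  by_contra hhO
  set v := O.valuation with hv
  have hf0 : f ≠ 0 := by rintro rfl; exact hfO (zero_mem O)
  have hhf : h * f ≠ 0 := mul_ne_zero hh hf0
  have hk1 : v (h * f)⁻¹ < 1 := inv_small O hhO
  have hk0 : (h * f)⁻¹ ≠ 0 := inv_ne_zero hhf
  have hs1 : v f⁻¹ < 1 := inv_small O hfO
  have hs0 : f⁻¹ ≠ 0 := inv_ne_zero hf0
  have hDs : D f⁻¹ = -(h * (1 - 1728 * f⁻¹)) := by
    rw [Derivation.leibniz_inv, hDf]
    simp only [smul_eq_mul]; field_simp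
  have hDk : D (h * f)⁻¹ = -(f⁻¹ * η) - f⁻¹ * (f - 1728) := by
    rw [Derivation.leibniz_inv, Derivation.leibniz, hDf, hDh]
    simp only [smul_eq_mul]; field_simp; ring
  have hkhs : (h * f)⁻¹ * h = f⁻¹ := by field_simp
  have hsf : f⁻¹ * f = 1 := inv_mul_cancel₀ hf0
  have hDξ : D (f⁻¹ * η) = h * f * (-(f⁻¹ * η) * (1 - 1728 * f⁻¹)
      - (1 - 1968 * f⁻¹ + 1161216 * f⁻¹ ^ 2) - (f⁻¹ * η) ^ 2 * (1 / 2)) := by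
    rw [Derivation.leibniz, hDs, hDη]
    simp only [smul_eq_mul]; field_simp; ring
  have hkhf : (h * f)⁻¹ * (h * f) = 1 := inv_mul_cancel₀ hhf
  set s := f⁻¹ with hs
  set k := (h * f)⁻¹ with hk
  set ξ := s * η with hξ
  have hnum : ∀ n : ℕ, (n : L) ∈ O := fun n => natCast_mem O n
  have hN : ∀ n : ℕ, [n.AtLeastTwo] → (OfNat.ofNat n : L) ∈ O := fun n _ => ofNat_mem O n
  have hsO := mem_of_small O hs1
  by_cases hξO : ξ ∈ O
  · let T : Set L := {s, k, ξ}
    have hsT : s ∈ genRing K T := genRing_T T (by simp [T])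
    have hkT : k ∈ genRing K T := genRing_T T (by simp [T])
    have hξT : ξ ∈ genRing K T := genRing_T T (by simp [T])
    have hs' : -(1 - 1728 * s) ∈ genRing K T :=
      Subring.neg_mem _ (Subring.sub_mem _ (Subring.one_mem _)
        (Subring.mul_mem _ (ofNat_mem _ 1728) hsT))
    have hEs : (k • D) s = s * -(1 - 1728 * s) := by
      rw [Derivation.smul_apply, hDs, smul_eq_mul]
      linear_combination -(1 - 1728 * s) * hkhs
    have hEk : (k • D) k = k * (-ξ + -(1 - 1728 * s)) := by
      rw [Derivation.smul_apply, hDk, smul_eq_mul]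
      linear_combination -k * hsf
    have hEξ : (k • D) ξ = ξ * -(1 - 1728 * s)
        - (1 - 1968 * s + 1161216 * s ^ 2) - ξ ^ 2 * (1 / 2) := by
      rw [Derivation.smul_apply, hDξ, smul_eq_mul]
      linear_combination (ξ * -(1 - 1728 * s)
        - (1 - 1968 * s + 1161216 * s ^ 2) - ξ ^ 2 * (1 / 2)) * hkhf
    have hYT : -ξ + -(1 - 1728 * s) ∈ genRing K T :=
      Subring.add_mem _ (Subring.neg_mem _ hξT) hs'
    have hQT : ξ * -(1 - 1728 * s)
        - (1 - 1968 * s + 1161216 * s ^ 2) - ξ ^ 2 * (1 / 2) ∈ genRing K T :=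
      Subring.sub_mem _ (Subring.sub_mem _ (Subring.mul_mem _ hξT hs')
        (Subring.add_mem _ (Subring.sub_mem _ (Subring.one_mem _)
          (Subring.mul_mem _ (ofNat_mem _ 1968) hsT))
          (Subring.mul_mem _ (ofNat_mem _ 1161216) (Subring.pow_mem _ hsT 2))))
        (Subring.mul_mem _ (Subring.pow_mem _ hξT 2) (genRing_half T))
    obtain ⟨h1, h2⟩ := core_gen hdep O hKO (k • D) T
      (by
        rintro t (rfl | rfl | rfl)
        exacts [hsO, mem_of_small O hk1, hξO])
      (by
        rintro t (rfl | rfl | rfl)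
        · rw [hEs]; exact Subring.mul_mem _ hsT hs'
        · rw [hEk]; exact Subring.mul_mem _ hkT hYT
        · rw [hEξ]; exact hQT)
      k _ hkT hk0 hk1 hYT hEk
      (by
        intro c
        obtain ⟨c', hc'⟩ := hDK c
        exact ⟨_, genRing_K T c', by rw [Derivation.smul_apply, hc', smul_eq_mul]⟩)
    have h4 := h1 ξ hξT
    rw [hEξ] at h4
    obtain ⟨m, n, hm, hn, hmn⟩ := h2 s _ hs0 hs1 hs' hEs
    refine natCast_not_lt O hKO (n := m ^ 2 + n ^ 2) (by positivity) ?_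
    have hmO := hnum m
    have hnO := hnum n
    have : ((m ^ 2 + n ^ 2 : ℕ) : L) =
        -(2 * n ^ 2) * (ξ * -(1 - 1728 * s)
          - (1 - 1968 * s + 1161216 * s ^ 2) - ξ ^ 2 * (1 / 2))
        + -(n * (ξ + 1) + m) * (m * -(1 - 1728 * s) - n * (-ξ + -(1 - 1728 * s)))
        + ((n * (ξ + 1) + m) * (m * 1728 - n * 1728)
            + 2 * n ^ 2 * (1728 * ξ + 1968 - 1161216 * s)) * s := by
      push_cast; ring
    rw [this]
    refine v.map_add_lt (v.map_add_lt (mem_nonunits_mul O h4 ?_) (mem_nonunits_mul O hmn ?_))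
        (mem_nonunits_mul O hs1 ?_)
    · exact neg_mem (mul_mem (hN 2) (pow_mem hnO 2))
    · exact neg_mem (add_mem (mul_mem hnO (add_mem hξO (one_mem O))) hmO)
    · exact add_mem (mul_mem (add_mem (mul_mem hnO (add_mem hξO (one_mem O))) hmO)
        (sub_mem (mul_mem hmO (hN 1728)) (mul_mem hnO (hN 1728))))
        (mul_mem (mul_mem (hN 2) (pow_mem hnO 2))
          (sub_mem (add_mem (mul_mem (hN 1728) hξO) (hN 1968)) (mul_mem (hN 1161216) hsO)))
  · have hξ0 : ξ ≠ 0 := by intro h0; rw [h0] at hξO; exact hξO (zero_mem O)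
    have hz1 : v ξ⁻¹ < 1 := inv_small O hξO
    have hz0 : ξ⁻¹ ≠ 0 := inv_ne_zero hξ0
    have hzξ : ξ⁻¹ * ξ = 1 := inv_mul_cancel₀ hξ0
    have hDz : D ξ⁻¹ = h * f * (ξ⁻¹ * (1 - 1728 * s)
      + (1 - 1968 * s + 1161216 * s ^ 2) * ξ⁻¹ ^ 2 + 1 / 2) := by
      rw [Derivation.leibniz_inv, hDξ]
      simp only [smul_eq_mul]
      clear_value ξ s
      field_simp; ring
    set z := ξ⁻¹ with hz
    let T : Set L := {s, k, z}
    have hsT : s ∈ genRing K T := genRing_T T (by simp [T])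
    have hkT : k ∈ genRing K T := genRing_T T (by simp [T])
    have hzT : z ∈ genRing K T := genRing_T T (by simp [T])
    have hs' : (1 - 1728 * s) ∈ genRing K T :=
      (Subring.sub_mem _ (Subring.one_mem _)
        (Subring.mul_mem _ (ofNat_mem _ 1728) hsT))
    have hEs : ((z * k) • D) s = -(z * (s * (1 - 1728 * s))) := by
      rw [Derivation.smul_apply, hDs, smul_eq_mul]
      linear_combination -z * (1 - 1728 * s) * hkhs
    have hEk : ((z * k) • D) k = k * (-1 - z * (1 - 1728 * s)) := by
      rw [Derivation.smul_apply, hDk, smul_eq_mul]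
      linear_combination -k * hzξ - k * z * hsf
    have hEz : ((z * k) • D) z = z * (z * (1 - 1728 * s)
      + (1 - 1968 * s + 1161216 * s ^ 2) * z ^ 2 + 1 / 2) := by
      rw [Derivation.smul_apply, hDz, smul_eq_mul]
      linear_combination z * (z * (1 - 1728 * s)
        + (1 - 1968 * s + 1161216 * s ^ 2) * z ^ 2 + 1 / 2) * hkhf
    have hYT : -1 - z * (1 - 1728 * s) ∈ genRing K T :=
      Subring.sub_mem _ (Subring.neg_mem _ (Subring.one_mem _)) (Subring.mul_mem _ hzT hs')
    have hQT : (z * (1 - 1728 * s)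
        + (1 - 1968 * s + 1161216 * s ^ 2) * z ^ 2 + 1 / 2) ∈ genRing K T :=
      Subring.add_mem _ (Subring.add_mem _ (Subring.mul_mem _ hzT hs')
        (Subring.mul_mem _ (Subring.add_mem _ (Subring.sub_mem _ (Subring.one_mem _)
          (Subring.mul_mem _ (ofNat_mem _ 1968) hsT))
          (Subring.mul_mem _ (ofNat_mem _ 1161216) (Subring.pow_mem _ hsT 2)))
          (Subring.pow_mem _ hzT 2))) (genRing_half T)
    obtain ⟨-, h2⟩ := core_gen hdep O hKO ((z * k) • D) T
      (by
        rintro t (rfl | rfl | rfl)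
        exacts [hsO, mem_of_small O hk1, mem_of_small O hz1])
      (by
        rintro t (rfl | rfl | rfl)
        · rw [hEs]
          exact Subring.neg_mem _ (Subring.mul_mem _ hzT (Subring.mul_mem _ hsT hs'))
        · rw [hEk]; exact Subring.mul_mem _ hkT hYT
        · rw [hEz]; exact Subring.mul_mem _ hzT hQT)
      k _ hkT hk0 hk1 hYT hEk
      (by
        intro c
        obtain ⟨c', hc'⟩ := hDK c
        exact ⟨z * algebraMap K L c', Subring.mul_mem _ hzT (genRing_K T c'), by
          rw [Derivation.smul_apply, hc', smul_eq_mul]; ring⟩)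
    obtain ⟨m, n, hm, hn, hmn⟩ := h2 z _ hz0 hz1 hQT hEz
    refine natCast_not_lt O hKO (n := m + 2 * n) (by positivity) ?_
    have hmO := hnum m
    have hnO := hnum n
    have hzO := mem_of_small O hz1
    have : ((m + 2 * n : ℕ) : L) =
        2 * (m * (z * (1 - 1728 * s)
          + (1 - 1968 * s + 1161216 * s ^ 2) * z ^ 2 + 1 / 2) - n * (-1 - z * (1 - 1728 * s)))
        + -(2 * (m * ((1 - 1728 * s) + (1 - 1968 * s + 1161216 * s ^ 2) * z)
            + n * (1 - 1728 * s))) * z := by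
      push_cast; ring
    rw [this]
    have h1728 : 1 - 1728 * s ∈ O := sub_mem (one_mem O) (mul_mem (hN 1728) hsO)
    refine v.map_add_lt (mem_nonunits_mul O hmn (hN 2)) (mem_nonunits_mul O hz1 ?_)
    exact neg_mem (mul_mem (hN 2) (add_mem (mul_mem hmO (add_mem h1728 (mul_mem
      (add_mem (sub_mem (one_mem O) (mul_mem (hN 1968) hsO)) (mul_mem (hN 1161216) (pow_mem hsO 2)))
      hzO))) (mul_mem hnO h1728)))

end places

/-- A solution of the `j`-equation in a differential field extension of transcendence degree at
most one is algebraic over the base. -/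
theorem core_thm {K L : Type*} [Field K] [Field L] [Algebra K L] [CharZero L]
    (D : Derivation ℤ L L) (hDK : ∀ c : K, ∃ c' : K, D (algebraMap K L c) = algebraMap K L c')
    (hdep : AlgDep K L) (f f1 f2 f3 : L) (hf1 : D f = f1) (hf2 : D f1 = f2) (hf3 : D f2 = f3)
    (h0 : f ≠ 0) (h1728 : f ≠ 1728) (hf10 : f1 ≠ 0)
    (heq : 2 * f3 * f1 * f ^ 2 * (f - 1728) ^ 2 - 3 * f2 ^ 2 * f ^ 2 * (f - 1728) ^ 2
        + 2 * f1 ^ 4 * (f ^ 2 - 1968 * f + 2654208) = 0) :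
    IsAlgebraic K f := by
  have h1 : f - 1728 ≠ 0 := sub_ne_zero.mpr h1728
  obtain ⟨p, hp⟩ : ∃ p, p = f * (f - 1728) := ⟨_, rfl⟩
  have hp0 : p ≠ 0 := hp ▸ mul_ne_zero h0 h1
  have hDp : D p = f1 * (2 * f - 1728) := by
    rw [hp, Derivation.leibniz, map_sub, hf1, D_ofNat]
    simp only [smul_eq_mul]; ring
  obtain ⟨h, hh⟩ : ∃ h, h = f1 / p := ⟨_, rfl⟩
  obtain ⟨η, hη⟩ : ∃ η, η = f2 * p / f1 ^ 2 - (2 * f - 1728) := ⟨_, rfl⟩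
  have hh0 : h ≠ 0 := by rw [hh]; exact div_ne_zero hf10 hp0
  have hDf : D f = h * (f * (f - 1728)) := by
    rw [hf1, hh, ← hp]; field_simp
  have hDh : D h = h ^ 2 * η := by
    rw [hh, Derivation.leibniz_div, hDp, hf2, hη]
    simp only [smul_eq_mul]
    field_simp
  have hDη : D η = h * (-(f ^ 2 - 1968 * f + 1161216) - η ^ 2 / 2) := by
    have e : D η = f3 * p / f1 ^ 2 + f2 * (2 * f - 1728) / f1 - 2 * f2 ^ 2 * p / f1 ^ 3
        - 2 * f1 := by
      rw [hη, map_sub, map_sub, Derivation.leibniz_div, Derivation.leibniz, Derivation.leibniz,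
        Derivation.leibniz_pow, hDp, hf3, hf2, D_ofNat, D_ofNat, hf1]
      simp only [smul_eq_mul, nsmul_eq_mul]
      push_cast
      field_simp
      ring
    have heq' : 2 * f3 * f1 * p ^ 2 - 3 * f2 ^ 2 * p ^ 2
        + 2 * f1 ^ 4 * (f ^ 2 - 1968 * f + 2654208) = 0 := by
      rw [← heq, hp]; ring
    rw [e, hη, hh]
    field_simp
    linear_combination heq' - 4 * f1 ^ 4 * hp
  by_contra hfa
  have aux : ∀ x : L, ¬ IsAlgebraic K x →
      ∃ O : ValuationSubring L, (∀ c : K, algebraMap K L c ∈ O) ∧ x ∉ O := by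
    intro x hx
    have hx' : x ∉ (integralClosure K L).toSubring := fun h => hx (IsIntegral.isAlgebraic h)
    have : IsIntegrallyClosedIn (integralClosure K L).toSubring L := 
      inferInstanceAs (IsIntegrallyClosedIn (integralClosure K L) L)
    obtain ⟨V, hV, hxV⟩ := Subring.exists_le_valuationSubring_of_isIntegrallyClosedIn hx'
    exact ⟨V, fun c => hV (algebraMap_mem (integralClosure K L) c), hxV⟩
  have hha : IsAlgebraic K h := by
    by_contra hc
    obtain ⟨O, hKO, hO⟩ := aux h hc
    by_cases hfO : f ∈ O
    · exact hO (place_finite D hDK hdep O hKO f h η hh0 hDf hDh hDη h0 h1 hfO)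
    · have h2 := place_infinite D hDK hdep O hKO f h η hh0 hDf hDh hDη hfO
      apply hO
      have : h = h * f * f⁻¹ := by field_simp
      rw [this]
      exact mul_mem h2 (mem_of_small O (inv_small O hfO))
  obtain ⟨O, hKO, hfO⟩ := aux f hfa
  have h2 := place_infinite D hDK hdep O hKO f h η hh0 hDf hDh hDη hfO
  have h3 : h⁻¹ ∈ O := by
    have h4 : IsIntegral K h⁻¹ := hha.inv.isIntegral
    have h5 : (integralClosure K L).toSubring ≤ O.toSubring := by
      intro x hx
      obtain ⟨q, hq, hqx⟩ := hx
      have hx : IsIntegral O x := by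
        let φ : K →+* O := (algebraMap K L).codRestrict O.toSubring hKO
        refine ⟨q.map φ, hq.map φ, ?_⟩
        rw [Polynomial.eval₂_map]
        exact hqx
      obtain ⟨y, rfl⟩ := IsIntegrallyClosed.isIntegral_iff.mp hx
      exact y.2
    exact h5 h4
  apply hfO
  have : f = h⁻¹ * (h * f) := by field_simp
  rw [this]
  exact mul_mem h3 h2

section tower

open Polynomial

lemma algDep_of_trdeg {K L : Type} [Field K] [Field L] [Algebra K L]
    (h : Algebra.trdeg K L ≤ 1) : AlgDep K L := by
  intro a b
  by_contra hc
  push Not at hc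
  have hind : AlgebraicIndependent K ![a, b] := by
    rw [algebraicIndependent_iff]
    intro p hp
    by_contra hp0
    apply hc ((Polynomial.Bivariate.equivMvPolynomial K).symm p) (by simpa using hp0)
    have : ∀ q : MvPolynomial (Fin 2) K, eval₂ (aeval (R := K) a).toRingHom b
        ((Polynomial.Bivariate.equivMvPolynomial K).symm q) = MvPolynomial.aeval ![a, b] q := by
      intro q
      induction q using MvPolynomial.induction_on with
      | C c => simp
      | add p q hp hq => rw [map_add, eval₂_add, map_add, hp, hq]
      | mul_X p i hp =>
        rw [map_mul, eval₂_mul, map_mul, hp]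
        congr 1
        fin_cases i <;> simp
    rw [this, hp]
  have := hind.cardinalMk_le_trdeg.trans h
  simp at this

lemma trdeg_alg {K M L : Type} [Field K] [Field M] [Field L] [Algebra K M] [Algebra M L]
    [Algebra K L] [IsScalarTower K M L] [Algebra.IsAlgebraic M L] :
    Algebra.trdeg K M = Algebra.trdeg K L := by
  have h3 := trdeg_add_eq K M (A := L)
  rwa [trdeg_eq_zero (R := M), add_zero] at h3

open scoped IntermediateField.algebraAdjoinAdjoin in
lemma trdeg_algClosure {K Ω : Type} [Field K] [Field Ω] [Algebra K Ω] (g : Ω) :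
    Algebra.trdeg K (algebraicClosure (IntermediateField.adjoin K {g}) Ω) ≤ 1 := by
  have h1 : Algebra.trdeg K (Algebra.adjoin K ({g} : Set Ω)) ≤ 1 := by
    rw [← Polynomial.trdeg_of_isDomain (R := K)]
    have hs : Function.Surjective ((aeval g : K[X] →ₐ[K] Ω).rangeRestrict) :=
      AlgHom.rangeRestrict_surjective _
    have := trdeg_le_of_surjective _ hs
    rwa [← Algebra.adjoin_singleton_eq_range_aeval] at this
  have h2 := trdeg_add_eq K (Algebra.adjoin K ({g} : Set Ω))
    (A := IntermediateField.adjoin K ({g} : Set Ω))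
  have : Algebra.IsAlgebraic (Algebra.adjoin K ({g} : Set Ω))
    (IntermediateField.adjoin K ({g} : Set Ω)) := inferInstance
  rw [trdeg_eq_zero (R := Algebra.adjoin K ({g} : Set Ω)), add_zero] at h2
  have h3 := trdeg_alg (K := K) (M := IntermediateField.adjoin K ({g} : Set Ω))
    (L := algebraicClosure (IntermediateField.adjoin K {g}) Ω)
  rw [← h3, ← h2]
  exact h1

lemma deriv_aeval {M Ω : Type} [Field M] [Field Ω] [Algebra M Ω] (D : Derivation ℤ Ω Ω)
    (hM : ∀ c : M, ∃ c' : M, D (algebraMap M Ω c) = algebraMap M Ω c') (x : Ω) (P : M[X]) :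
    ∃ Q : M[X], D (aeval x P) = aeval x Q + aeval x (derivative P) * D x := by
  induction P using Polynomial.induction_on' with
  | add p q hp hq =>
    obtain ⟨P, hP⟩ := hp
    obtain ⟨Q, hQ⟩ := hq
    exact ⟨P + Q, by simp only [map_add, hP, hQ]; ring⟩
  | monomial n a =>
    obtain ⟨b, hb⟩ := hM a
    refine ⟨monomial n b, ?_⟩
    rw [derivative_monomial, aeval_monomial, aeval_monomial, aeval_monomial, Derivation.leibniz,
      Derivation.leibniz_pow, hb]
    simp
    ring

lemma algClosure_stable {M Ω : Type} [Field M] [Field Ω] [Algebra M Ω] [CharZero M]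
    (D : Derivation ℤ Ω Ω)
    (hM : ∀ c : M, ∃ c' : M, D (algebraMap M Ω c) = algebraMap M Ω c') (x : Ω)
    (hx : IsAlgebraic M x) : IsAlgebraic M (D x) := by
  obtain ⟨Q, hQ⟩ := deriv_aeval D hM x (minpoly M x)
  rw [minpoly.aeval, map_zero] at hQ
  have hs := (minpoly.irreducible hx.isIntegral).separable
  have h0 := hs.aeval_derivative_ne_zero (minpoly.aeval M x)
  have : D x = - (aeval x Q / aeval x (derivative (minpoly M x))) := by
    field_simp
    linear_combination -hQ
  rw [this]
  have h2 : ∀ P : M[X], IsAlgebraic M (aeval x P) := fun P => by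
    have := Algebra.adjoin_le (S := (algebraicClosure M Ω).toSubalgebra) (s := {x})
      (by rintro _ rfl; exact mem_algebraicClosure_iff.mpr hx)
    exact mem_algebraicClosure_iff.mp (this (aeval_mem_adjoin_singleton M x))
  exact (div_eq_mul_inv (aeval x Q) _ ▸ (h2 _).mul (h2 _).inv).neg

/-- One step of the tower. -/
lemma tower_step {K Ω : Type} [Field K] [Field Ω] [Algebra K Ω] [CharZero K]
    (D : Derivation ℤ Ω Ω)
    (hK : ∀ c : K, ∃ c' : K, D (algebraMap K Ω c) = algebraMap K Ω c') (g : Ω)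
    (hg : D g ∈ IntermediateField.adjoin K {g})
    (f : Ω) (h0 : f ≠ 0) (h1728 : f ≠ 1728) (hf10 : D f ≠ 0)
    (heq : 2 * D (D (D f)) * D f * f ^ 2 * (f - 1728) ^ 2 - 3 * D (D f) ^ 2 * f ^ 2 * (f - 1728) ^ 2
        + 2 * D f ^ 4 * (f ^ 2 - 1968 * f + 2654208) = 0)
    (hf : IsAlgebraic (IntermediateField.adjoin K {g}) f) :
    IsAlgebraic K f := by
  let M := IntermediateField.adjoin K {g}
  let L := algebraicClosure M Ω
  have hM : ∀ c : M, ∃ c' : M, D (algebraMap M Ω c) = algebraMap M Ω c' := by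
    rintro ⟨c, hc⟩
    suffices D c ∈ M from ⟨⟨_, this⟩, rfl⟩
    induction hc using IntermediateField.adjoin_induction with
    | mem x hx => rw [Set.mem_singleton_iff] at hx; subst hx; exact hg
    | algebraMap x => obtain ⟨y, hy⟩ := hK x; rw [hy]; exact M.algebraMap_mem y
    | add x y hx hy h1 h2 => rw [map_add]; exact M.add_mem h1 h2
    | inv x hx h1 =>
      rw [Derivation.leibniz_inv]
      exact M.mul_mem (M.neg_mem (pow_mem (M.inv_mem hx) 2)) h1
    | mul x y hx hy h1 h2 =>
      rw [Derivation.leibniz]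
      exact M.add_mem (M.mul_mem hx h2) (M.mul_mem hy h1)
  have : CharZero M := charZero_of_injective_algebraMap (algebraMap K M).injective
  have : CharZero L := charZero_of_injective_algebraMap (algebraMap M L).injective
  have hL : ∀ x : L, D x ∈ L := fun x =>
    mem_algebraicClosure_iff.mpr (algClosure_stable D hM x (mem_algebraicClosure_iff.mp x.2))
  let D' : Derivation ℤ L L := Derivation.mk'
    (AddMonoidHom.toIntLinearMap
      { toFun := fun x => ⟨D x, hL x⟩
        map_zero' := by ext; simp
        map_add' := fun x y => by ext; simp })
    (fun a b => by ext; simp)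
  have hD' : ∀ x : L, (D' x : Ω) = D x := fun x => rfl
  have := core_thm (K := K) D' ?_ (algDep_of_trdeg (trdeg_algClosure g)) 
    ⟨f, mem_algebraicClosure_iff.mpr hf⟩ _ _ _ rfl rfl rfl
    ?_ ?_ ?_ ?_
  · have _ : IsScalarTower K L Ω := IsScalarTower.of_algebraMap_eq (fun x => rfl)
    exact this.algebraMap (A := Ω)
  · intro c
    obtain ⟨c', hc'⟩ := hK c
    exact ⟨c', Subtype.ext hc'⟩
  · intro h; exact h0 (congrArg Subtype.val h)
  · intro h; exact h1728 (congrArg Subtype.val h)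
  · intro h; exact hf10 (congrArg Subtype.val h)
  · exact Subtype.ext heq

lemma isAlgebraic_mono {A B Ω : Type} [Field A] [Field B] [Field Ω] [Algebra A Ω] [Algebra B Ω]
    (h : ∀ a : A, ∃ b : B, algebraMap B Ω b = algebraMap A Ω a) (f : Ω) (hf : IsAlgebraic A f) :
    IsAlgebraic B f := by
  choose φ hφ using h
  have hi := (algebraMap B Ω).injective
  let ψ : A →+* B :=
    { toFun := φ
      map_one' := hi (by rw [hφ, map_one, map_one])
      map_zero' := hi (by rw [hφ, map_zero, map_zero])
      map_add' := fun x y => hi (by rw [hφ, map_add, map_add, hφ, hφ])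
      map_mul' := fun x y => hi (by rw [hφ, map_mul, map_mul, hφ, hφ]) }
  have hψ : (algebraMap B Ω).comp ψ = algebraMap A Ω := RingHom.ext hφ
  obtain ⟨P, hP, hPf⟩ := hf
  refine ⟨P.map ψ, (Polynomial.map_ne_zero_iff ψ.injective).mpr hP, ?_⟩
  rw [aeval_def, eval₂_map, hψ]
  exact hPf

/-- The fields of the tower. -/
noncomputable def towerField {Ω : Type} [Field Ω] [Algebra ℂ Ω] (z : Ω) (g : ℕ → Ω) (n : ℕ) :
    IntermediateField ℂ Ω :=
  IntermediateField.adjoin ℂ ({z} ∪ g '' Set.Iio n)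

lemma towerField_mono {Ω : Type} [Field Ω] [Algebra ℂ Ω] (z : Ω) (g : ℕ → Ω) {m n : ℕ}
    (h : m ≤ n) : towerField z g m ≤ towerField z g n :=
  IntermediateField.adjoin.mono _ _ _
    (Set.union_subset_union_right _ (Set.image_mono (Set.Iio_subset_Iio h)))

lemma towerField_stable {Ω : Type} [Field Ω] [Algebra ℂ Ω] (D : Derivation ℤ Ω Ω)
    (hC : ∀ c : ℂ, D (algebraMap ℂ Ω c) = 0) (z : Ω) (g : ℕ → Ω)
    (hz : D z ∈ towerField z g 0) (hg : ∀ n, D (g n) ∈ towerField z g (n + 1)) (n : ℕ) (x : Ω)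
    (hx : x ∈ towerField z g n) : D x ∈ towerField z g n := by
  have hM : ∀ y ∈ ({z} ∪ g '' Set.Iio n : Set Ω), D y ∈ towerField z g n := by
    rintro y (rfl | ⟨m, hm, rfl⟩)
    · exact towerField_mono _ _ (Nat.zero_le n) hz
    · exact towerField_mono _ _ (Nat.succ_le_of_lt hm) (hg m)
  unfold towerField at hx
  induction hx using IntermediateField.adjoin_induction with
  | mem x hx => exact hM x hx
  | algebraMap x => rw [hC]; exact zero_mem _
  | add x y hx hy h1 h2 => rw [map_add]; exact add_mem h1 h2
  | inv x hx h1 =>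
    rw [Derivation.leibniz_inv]
    exact mul_mem (neg_mem (pow_mem (inv_mem hx) 2)) h1
  | mul x y hx hy h1 h2 =>
    rw [Derivation.leibniz]
    exact add_mem (mul_mem hx h2) (mul_mem hy h1)

lemma towerField_succ {Ω : Type} [Field Ω] [Algebra ℂ Ω] (z : Ω) (g : ℕ → Ω) (n : ℕ) (x : Ω)
    (hx : x ∈ towerField z g (n + 1)) :
    x ∈ IntermediateField.adjoin (towerField z g n) {g n} := by
  have : towerField z g (n + 1) =
      (IntermediateField.adjoin (towerField z g n) {g n}).restrictScalars ℂ := by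
    unfold towerField
    rw [IntermediateField.adjoin_adjoin_left, Set.union_assoc]
    congr 2
    ext y
    simp only [Set.mem_image, Set.mem_Iio, Set.mem_union, Set.mem_singleton_iff]
    constructor
    · rintro ⟨m, hm, rfl⟩
      rcases Nat.lt_succ_iff_lt_or_eq.mp hm with h | rfl
      · exact Or.inl ⟨m, h, rfl⟩
      · exact Or.inr rfl
    · rintro (⟨m, hm, rfl⟩ | rfl)
      · exact ⟨m, by omega, rfl⟩
      · exact ⟨n, by omega, rfl⟩
  rw [this] at hx
  exact hx

theorem tower_thm {Ω : Type} [Field Ω] [Algebra ℂ Ω] (D : Derivation ℤ Ω Ω)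
    (hC : ∀ c : ℂ, D (algebraMap ℂ Ω c) = 0) (z : Ω) (g : ℕ → Ω)
    (hz : D z ∈ towerField z g 0) (hg : ∀ n, D (g n) ∈ towerField z g (n + 1))
    (f : Ω) (h0 : f ≠ 0) (h1728 : f ≠ 1728) (hf10 : D f ≠ 0)
    (heq : 2 * D (D (D f)) * D f * f ^ 2 * (f - 1728) ^ 2 - 3 * D (D f) ^ 2 * f ^ 2 * (f - 1728) ^ 2
        + 2 * D f ^ 4 * (f ^ 2 - 1968 * f + 2654208) = 0)
    (n : ℕ) (hf : IsAlgebraic (towerField z g n) f) : IsAlgebraic (towerField z g 0) f := by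
  induction n with
  | zero => exact hf
  | succ n ih =>
    apply ih
    have : CharZero (towerField z g n) :=
      charZero_of_injective_algebraMap (algebraMap ℂ _).injective
    refine tower_step D ?_ (g n) (towerField_succ z g n _ (hg n)) f h0 h1728 hf10 heq ?_
    · intro c
      exact ⟨⟨_, towerField_stable D hC z g hz hg n c c.2⟩, rfl⟩
    · refine isAlgebraic_mono ?_ f hf
      intro a
      exact ⟨⟨a, towerField_succ z g n a a.2⟩, rfl⟩

lemma exists_mv {Ω : Type} [Field Ω] [Algebra ℂ Ω] (z : Ω) (g : ℕ → Ω) (f : Ω)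
    (hf : IsAlgebraic (towerField z g 0) f) :
    ∃ P : MvPolynomial (Fin 2) ℂ, P ≠ 0 ∧ MvPolynomial.aeval ![z, f] P = 0 := by
  have hs : ({z} ∪ g '' Set.Iio 0 : Set Ω) = {z} := by simp
  unfold towerField at hf
  rw [hs] at hf
  by_contra hc
  push Not at hc
  have hind : AlgebraicIndependent ℂ ![z, f] := by
    rw [algebraicIndependent_iff]
    intro p hp
    by_contra hp0
    exact hc p hp0 hp
  let M := IntermediateField.adjoin ℂ ({z} : Set Ω)
  let L := algebraicClosure M Ω
  have hz : z ∈ L := L.algebraMap_mem (⟨z, IntermediateField.mem_adjoin_simple_self ℂ z⟩ : M)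
  have : AlgebraicIndependent ℂ (![⟨z, hz⟩, ⟨f, mem_algebraicClosure_iff.mpr hf⟩] : Fin 2 → L) := by
    have _ : IsScalarTower ℂ L Ω := IsScalarTower.of_algebraMap_eq (fun x => rfl)
    apply AlgebraicIndependent.of_comp (IsScalarTower.toAlgHom ℂ L Ω)
    convert hind using 1
    ext i
    fin_cases i <;> rfl
  have := this.cardinalMk_le_trdeg.trans (trdeg_algClosure z)
  simp at this

/-- Extension of a derivation to the field of fractions. -/
theorem exists_fraction_derivation (A : Type) [CommRing A] [IsDomain A] [Algebra ℂ A]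
    (d : Derivation ℂ A A) :
    ∃ D : Derivation ℂ (FractionRing A) (FractionRing A),
      ∀ a, D (algebraMap A (FractionRing A) a) = algebraMap A (FractionRing A) (d a) := by
  have : Algebra.FormallyEtale A (FractionRing A) :=
    Algebra.FormallyEtale.of_isLocalization (nonZeroDivisors A)
  let d1 : Derivation ℂ A (FractionRing A) := (Algebra.linearMap A (FractionRing A)).compDer d
  refine ⟨(((d1.liftKaehlerDifferential).liftBaseChange (FractionRing A)).comp
    (KaehlerDifferential.tensorKaehlerEquivOfFormallyEtale ℂ A
      (FractionRing A)).symm.toLinearMap).compDer (KaehlerDifferential.D ℂ (FractionRing A)), ?_⟩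
  intro a
  have := KaehlerDifferential.tensorKaehlerEquivOfFormallyEtale_symm_D_algebraMap ℂ
    A (FractionRing A) a
  simp [this, d1]

end tower

section taylor

open Topology Filter

/-- Functions of a real variable analytic at the origin. -/
noncomputable def anaAlg : Subalgebra ℂ (ℝ → ℂ) where
  carrier := {h | AnalyticAt ℝ h 0}
  mul_mem' := fun ha hb => AnalyticAt.mul ha hb
  add_mem' := fun ha hb => AnalyticAt.add ha hb
  algebraMap_mem' := fun _ => analyticAt_const

lemma mem_anaAlg {h : ℝ → ℂ} : h ∈ anaAlg ↔ AnalyticAt ℝ h 0 := Iff.rfl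

/-- The Taylor series at the origin. -/
noncomputable def taylorSeries (h : ℝ → ℂ) : PowerSeries ℂ :=
  PowerSeries.mk fun n => iteratedDeriv n h 0 / (n.factorial : ℂ)

/-- The Taylor series as an algebra homomorphism. -/
noncomputable def taylorHom : anaAlg →ₐ[ℂ] PowerSeries ℂ where
  toFun h := taylorSeries h
  map_one' := by
    ext n
    rw [taylorSeries, PowerSeries.coeff_mk, PowerSeries.coeff_one]
    change iteratedDeriv n (fun _ => (1 : ℂ)) 0 / _ = _
    rw [iteratedDeriv_const]
    split_ifs with h
    · subst h; simp
    · simp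
  map_zero' := by
    ext n
    rw [taylorSeries, PowerSeries.coeff_mk]
    change iteratedDeriv n (fun _ => (0 : ℂ)) 0 / _ = _
    rw [iteratedDeriv_const]
    simp
  map_add' := fun a b => by
    ext n
    rw [map_add, taylorSeries, taylorSeries, taylorSeries, PowerSeries.coeff_mk,
      PowerSeries.coeff_mk, PowerSeries.coeff_mk]
    change iteratedDeriv n ((a : ℝ → ℂ) + (b : ℝ → ℂ)) 0 / _ = _
    rw [iteratedDeriv_add (AnalyticAt.contDiffAt a.2) (AnalyticAt.contDiffAt b.2), add_div]
  map_mul' := fun a b => by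
    ext n
    rw [PowerSeries.coeff_mul, taylorSeries, taylorSeries, taylorSeries, PowerSeries.coeff_mk]
    change iteratedDeriv n ((a : ℝ → ℂ) * (b : ℝ → ℂ)) 0 / _ = _
    rw [iteratedDeriv_mul (AnalyticAt.contDiffAt a.2) (AnalyticAt.contDiffAt b.2),
      Finset.Nat.sum_antidiagonal_eq_sum_range_succ_mk, Finset.sum_div]
    refine Finset.sum_congr rfl fun i hi => ?_
    have hi : i ≤ n := Nat.lt_succ_iff.mp (Finset.mem_range.mp hi)
    rw [PowerSeries.coeff_mk, PowerSeries.coeff_mk, Nat.cast_choose ℂ hi]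
    have := n.factorial_ne_zero
    have := i.factorial_ne_zero
    have := (n - i).factorial_ne_zero
    field_simp
  commutes' := fun c => by
    ext n
    rw [taylorSeries, PowerSeries.coeff_mk]
    change iteratedDeriv n (fun _ => c) 0 / _ = PowerSeries.coeff n (PowerSeries.C c)
    rw [iteratedDeriv_const, PowerSeries.coeff_C]
    split_ifs with h
    · subst h; simp
    · simp

theorem exists_taylor : ∃ (Ω : Type) (_ : Field Ω) (_ : Algebra ℂ Ω) (D : Derivation ℂ Ω Ω)
    (Φ : anaAlg →ₐ[ℂ] Ω),
    (∀ a b : anaAlg, (a : ℝ → ℂ) =ᶠ[𝓝 0] b → Φ a = Φ b) ∧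
    (∀ a b : anaAlg, deriv (a : ℝ → ℂ) =ᶠ[𝓝 0] b → D (Φ a) = Φ b) ∧
    (∀ a : anaAlg, (a : ℝ → ℂ) 0 ≠ 0 → Φ a ≠ 0) ∧
    (∀ a : anaAlg, Φ a = 0 → (a : ℝ → ℂ) =ᶠ[𝓝 0] 0) := by
  obtain ⟨D, hD⟩ := exists_fraction_derivation (PowerSeries ℂ) (PowerSeries.derivative ℂ)
  have inj := IsFractionRing.injective (PowerSeries ℂ) (FractionRing (PowerSeries ℂ))
  have hcongr : ∀ a b : ℝ → ℂ, a =ᶠ[𝓝 0] b → taylorSeries a = taylorSeries b := by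
    intro a b hab
    ext n
    rw [taylorSeries, taylorSeries, PowerSeries.coeff_mk, PowerSeries.coeff_mk,
      hab.iteratedDeriv_eq]
  have hz : ∀ a : anaAlg, taylorHom a = 0 → ∀ n, iteratedDeriv n (a : ℝ → ℂ) 0 = 0 := by
    intro a ha n
    have h1 : taylorSeries a = 0 := ha
    have : PowerSeries.coeff n (taylorSeries a) = 0 := by rw [h1, map_zero]
    rw [taylorSeries, PowerSeries.coeff_mk, div_eq_zero_iff] at this
    exact this.resolve_right (by exact_mod_cast n.factorial_ne_zero)
  refine ⟨FractionRing (PowerSeries ℂ), inferInstance, inferInstance, D,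
    (IsScalarTower.toAlgHom ℂ (PowerSeries ℂ) (FractionRing (PowerSeries ℂ))).comp taylorHom,
    ?_, ?_, ?_, ?_⟩
  · intro a b hab
    exact congrArg (algebraMap _ _) (hcongr a b hab)
  · intro a b hab
    refine (hD _).trans (congrArg (algebraMap _ _) ?_)
    change _ = taylorSeries b
    rw [← hcongr _ _ hab]
    change PowerSeries.derivative ℂ (taylorSeries a) = _
    ext n
    rw [PowerSeries.coeff_derivative, taylorSeries, taylorSeries, PowerSeries.coeff_mk,
      PowerSeries.coeff_mk, iteratedDeriv_succ', Nat.factorial_succ]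
    have := n.factorial_ne_zero
    have : (n + 1 : ℂ) ≠ 0 := by exact_mod_cast n.succ_ne_zero
    push_cast
    field_simp
  · intro a ha h
    have h1 : taylorHom a = 0 := inj (by rw [map_zero]; exact h)
    have := hz a h1 0
    rw [iteratedDeriv_zero] at this
    exact ha this
  · intro a h
    have h1 : taylorHom a = 0 := inj (by rw [map_zero]; exact h)
    have h2 := hz a h1
    have h3 : analyticOrderAt (a : ℝ → ℂ) 0 = ⊤ := by
      rw [ENat.eq_top_iff_forall_ge]
      intro n
      rw [natCast_le_analyticOrderAt_iff_iteratedDeriv_eq_zero a.2]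
      exact fun i _ => h2 i
    exact analyticOrderAt_eq_top.mp h3

end taylor

section germs

open Topology Filter

/-- Functions on the plane real-analytic at `z0`. -/
noncomputable def germAlg (z0 : ℂ) : Subalgebra ℂ (ℂ → ℂ) where
  carrier := {h | AnalyticAt ℝ h z0}
  mul_mem' := fun ha hb => AnalyticAt.mul ha hb
  add_mem' := fun ha hb => AnalyticAt.add ha hb
  algebraMap_mem' := fun _ => analyticAt_const

lemma path_analytic (z0 : ℂ) : AnalyticAt ℝ (fun t : ℝ => z0 + (t : ℂ)) 0 :=
  analyticAt_const.add (Complex.ofRealCLM.analyticAt 0)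

lemma path_tendsto (z0 : ℂ) : Tendsto (fun t : ℝ => z0 + (t : ℂ)) (𝓝 0) (𝓝 z0) := by
  have := (path_analytic z0).continuousAt.tendsto
  simpa using this

/-- Restriction to the horizontal line through `z0`. -/
noncomputable def restrictHom (z0 : ℂ) : germAlg z0 →ₐ[ℂ] anaAlg where
  toFun h := ⟨fun t => (h : ℂ → ℂ) (z0 + t), by
    have h2 : AnalyticAt ℝ (h : ℂ → ℂ) z0 := h.2
    refine AnalyticAt.fun_comp ?_ (path_analytic z0)
    simpa using h2⟩
  map_one' := rfl
  map_zero' := rfl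
  map_add' _ _ := rfl
  map_mul' _ _ := rfl
  commutes' _ := rfl

theorem exists_germ (z0 : ℂ) : ∃ (Ω : Type) (_ : Field Ω) (_ : Algebra ℂ Ω) (D : Derivation ℂ Ω Ω)
    (Ψ : germAlg z0 →ₐ[ℂ] Ω),
    (∀ a b : germAlg z0, (∀ t : ℝ, (a : ℂ → ℂ) (z0 + t) = (b : ℂ → ℂ) (z0 + t)) → Ψ a = Ψ b) ∧
    (∀ a b : germAlg z0, (a : ℂ → ℂ) =ᶠ[𝓝 z0] b → Ψ a = Ψ b) ∧
    (∀ a b : germAlg z0,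
      (∀ᶠ z in 𝓝 z0, HasDerivAt (fun t : ℝ => (a : ℂ → ℂ) (z + t)) ((b : ℂ → ℂ) z) 0) →
      D (Ψ a) = Ψ b) ∧
    (∀ a : germAlg z0, (a : ℂ → ℂ) z0 ≠ 0 → Ψ a ≠ 0) ∧
    (∀ a : germAlg z0, Ψ a = 0 → ∀ᶠ t : ℝ in 𝓝 0, (a : ℂ → ℂ) (z0 + t) = 0) := by
  obtain ⟨Ω, i1, i2, D, Φ, h1, h2, h3, h4⟩ := exists_taylor
  refine ⟨Ω, i1, i2, D, Φ.comp (restrictHom z0), ?_, ?_, ?_, ?_, ?_⟩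
  · intro a b hab
    exact h1 _ _ (Eventually.of_forall hab)
  · intro a b hab
    exact h1 _ _ ((path_tendsto z0).eventually hab)
  · intro a b hab
    apply h2
    filter_upwards [(path_tendsto z0).eventually hab] with t ht
    apply HasDerivAt.deriv
    have h5 : HasDerivAt (fun s : ℝ => (a : ℂ → ℂ) (z0 + t + ((s - t : ℝ) : ℂ)))
        ((b : ℂ → ℂ) (z0 + t)) t := by
      have := HasDerivAt.comp_sub_const (f := fun s : ℝ => (a : ℂ → ℂ) (z0 + t + (s : ℂ))) t t
        (f' := (b : ℂ → ℂ) (z0 + t)) (by simpa using ht)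
      exact this
    refine h5.congr_of_eventuallyEq (Eventually.of_forall fun s => ?_)
    change (a : ℂ → ℂ) (z0 + s) = (a : ℂ → ℂ) (z0 + t + ((s - t : ℝ) : ℂ))
    push_cast
    ring_nf
  · intro a ha
    apply h3
    change (a : ℂ → ℂ) (z0 + ((0 : ℝ) : ℂ)) ≠ 0
    simpa using ha
  · intro a ha
    exact h4 _ ha

lemma hasDerivAt_of_real {g : ℂ → ℝ} {z : ℂ} (h : DifferentiableAt ℝ g z) :
    HasDerivAt (fun t : ℝ => (g (z + t) : ℂ)) ((fderiv ℝ g z 1 : ℝ) : ℂ) 0 := by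
  have h1 : HasDerivAt (fun t : ℝ => z + (t : ℂ)) 1 0 :=
    (Complex.ofRealCLM.hasDerivAt (x := (0 : ℝ))).const_add z
  have h2 : HasFDerivAt g (fderiv ℝ g z) (z + ((0 : ℝ) : ℂ)) := by
    simpa using h.hasFDerivAt
  exact (h2.comp_hasDerivAt 0 h1).ofReal_comp

lemma hasDerivAt_of_complex {f : ℂ → ℂ} {z : ℂ} (h : DifferentiableAt ℂ f z) :
    HasDerivAt (fun t : ℝ => f (z + t)) (deriv f z) 0 := by
  have h1 : HasDerivAt (fun t : ℝ => z + (t : ℂ)) 1 0 :=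
    (Complex.ofRealCLM.hasDerivAt (x := (0 : ℝ))).const_add z
  have h2 : HasDerivAt f (deriv f z) (z + ((0 : ℝ) : ℂ)) := by
    simpa using h.hasDerivAt
  have := h2.comp (0 : ℝ) h1
  rwa [mul_one] at this

lemma germ_aeval_apply {σ : Type} {z0 : ℂ} (W : σ → germAlg z0) (Q : MvPolynomial σ ℂ) (z : ℂ) :
    (MvPolynomial.aeval W Q : germAlg z0).1 z = MvPolynomial.eval (fun i => (W i).1 z) Q := by
  have h := MvPolynomial.comp_aeval_apply W ((Pi.evalAlgHom ℂ (fun _ : ℂ => ℂ) z).comp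
    (germAlg z0).val) Q
  exact h

lemma eval_ofReal {σ : Type} (w : σ → ℝ) (q : MvPolynomial σ ℝ) :
    MvPolynomial.eval (fun i => (w i : ℂ)) (q.map Complex.ofRealHom) =
      ((MvPolynomial.eval w q : ℝ) : ℂ) := by
  induction q using MvPolynomial.induction_on with
  | C c => simp
  | add p q hp hq => simp only [map_add, hp, hq, Complex.ofReal_add]
  | mul_X p i hp => simp only [map_mul, hp, Complex.ofReal_mul, MvPolynomial.map_X,
      MvPolynomial.eval_X]

/-- The vector of germs of coordinates and chain functions. -/
def coordVec {A : Type} (x y : A) {m : ℕ} (W : Fin m → A) : Fin (m + 2) → A :=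
  Fin.cons x (Fin.cons y W)

lemma germ_coord {z0 : ℂ} {m : ℕ} (x y : germAlg z0) (W : Fin m → germAlg z0)
    (w : Fin m → ℂ → ℝ) (z : ℂ) (hx : x.1 z = (z.re : ℂ)) (hy : y.1 z = (z.im : ℂ))
    (hW : ∀ j, (W j).1 z = (w j z : ℂ)) (q : MvPolynomial (Fin (m + 2)) ℝ) :
    (MvPolynomial.aeval (coordVec x y W) (q.map Complex.ofRealHom) : germAlg z0).1 z =
      ((MvPolynomial.eval (Fin.cons z.re (Fin.cons z.im fun j => w j z)) q : ℝ) : ℂ) := by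
  rw [germ_aeval_apply, ← eval_ofReal]
  congr 2
  funext i
  refine Fin.cases ?_ (fun i => Fin.cases ?_ (fun j => ?_) i) i
  · exact hx
  · exact hy
  · exact hW j

lemma aeval_mem_field {Ω : Type} [Field Ω] [Algebra ℂ Ω] (K : IntermediateField ℂ Ω) {m : ℕ}
    (x y : Ω) (W : Fin m → Ω) (hx : x ∈ K) (hy : y ∈ K) (hW : ∀ j, W j ∈ K)
    (Q : MvPolynomial (Fin (m + 2)) ℂ) : MvPolynomial.aeval (coordVec x y W) Q ∈ K := by
  have hv : ∀ i, coordVec x y W i ∈ K := fun i => by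
    refine Fin.cases ?_ (fun i => Fin.cases ?_ (fun j => ?_) i) i
    · exact hx
    · exact hy
    · exact hW j
  induction Q using MvPolynomial.induction_on with
  | C c => rw [MvPolynomial.aeval_C]; exact K.algebraMap_mem c
  | add p q hp hq => rw [map_add]; exact add_mem hp hq
  | mul_X p i hp => rw [map_mul, MvPolynomial.aeval_X]; exact mul_mem hp (hv i)

lemma map_coordVec {A B : Type} (F : A → B) (x y : A) {m : ℕ} (W : Fin m → A) :
    (fun i => F (coordVec x y W i)) = coordVec (F x) (F y) fun j => F (W j) := by
  funext i
  refine Fin.cases ?_ (fun i => Fin.cases ?_ (fun j => ?_) i) i <;> rfl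

lemma isAlg_of_rel {Ω : Type} [Field Ω] [Algebra ℂ Ω] (K : IntermediateField ℂ Ω) (n : ℕ)
    (c : Fin (n + 1) → Ω) (hc : ∀ k, c k ∈ K) (k0 : Fin (n + 1)) (h0 : c k0 ≠ 0) (u : Ω)
    (h : ∑ k : Fin (n + 1), c k * u ^ (k : ℕ) = 0) : IsAlgebraic K u := by
  refine ⟨∑ k : Fin (n + 1), Polynomial.monomial (k : ℕ) (⟨c k, hc k⟩ : K), ?_, ?_⟩
  · intro hP
    apply h0
    have h1 := congrArg (fun P => Polynomial.coeff P (k0 : ℕ)) hP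
    simp only [Polynomial.finsetSum_coeff, Polynomial.coeff_monomial, Polynomial.coeff_zero,
      Fin.val_inj, Finset.sum_ite_eq', Finset.mem_univ, if_true] at h1
    exact congrArg Subtype.val h1
  · rw [map_sum]
    simp only [Polynomial.aeval_monomial]
    exact h

end germs

section goodpoint

open Topology Filter

lemma coord_analytic (V : Set ℂ) {l : ℕ} (g : Fin l → ℂ → ℝ)
    (hga : ∀ i, AnalyticOnNhd ℝ (g i) V) (q : MvPolynomial (Fin (l + 2)) ℝ) :
    AnalyticOnNhd ℝ (fun z => MvPolynomial.eval
      (Fin.cons z.re (Fin.cons z.im fun j => g j z) : Fin (l + 2) → ℝ) q) V := by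
  intro z hz
  refine AnalyticAt.aeval_mvPolynomial (𝕜 := ℝ)
    (f := fun z : ℂ => (Fin.cons z.re (Fin.cons z.im fun j => g j z) : Fin (l + 2) → ℝ))
    (z := z) (fun i => ?_) q
  refine Fin.cases ?_ (fun i => Fin.cases ?_ (fun j => ?_) i) i
  · exact Complex.reCLM.analyticAt z
  · exact Complex.imCLM.analyticAt z
  · exact hga j z hz

lemma exists_good_point (V : Set ℂ) (hVo : IsOpen V) (hVc : IsPreconnected V) {l : ℕ}
    (g : Fin l → ℂ → ℝ) (hga : ∀ i, AnalyticOnNhd ℝ (g i) V)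
    (a b : MvPolynomial (Fin (l + 2)) ℝ)
    (ha : ¬ ∀ z ∈ V, MvPolynomial.eval (Fin.cons z.re (Fin.cons z.im fun j => g j z)) a = 0)
    (hb : ¬ ∀ z ∈ V, MvPolynomial.eval (Fin.cons z.re (Fin.cons z.im fun j => g j z)) b = 0) :
    ∃ z ∈ V, MvPolynomial.eval (Fin.cons z.re (Fin.cons z.im fun j => g j z)) a ≠ 0 ∧
      MvPolynomial.eval (Fin.cons z.re (Fin.cons z.im fun j => g j z)) b ≠ 0 := by
  by_contra hc
  push Not at hc ha
  obtain ⟨z1, hz1, ha1⟩ := ha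
  apply hb
  refine (coord_analytic V g hga b).eqOn_zero_of_preconnected_of_eventuallyEq_zero hVc hz1 ?_
  have h1 := (coord_analytic V g hga a z1 hz1).continuousAt.eventually_ne ha1
  filter_upwards [h1, hVo.mem_nhds hz1] with z hz hzV
  exact hc z hzV hz

end goodpoint

open Topology Filter in
/-- Let `V` be a connected open subset of the upper half-plane and `f`
holomorphic on `V` with `f' ≠ 0`, `f ≠ 0`, `f ≠ 1728` on `V`, satisfying the `j`-equation
and transcendental over `ℂ(z)`.  Then there is no Pfaffian chain of real-analytic functions
on `V` over which both `Re f` and `Im f` are algebraic. -/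
theorem statement_7 (V : Set ℂ) (hVo : IsOpen V) (hVc : IsPreconnected V)
    (hVH : ∀ z ∈ V, 0 < z.im)
    (f : ℂ → ℂ) (hf : DifferentiableOn ℂ f V)
    (hf' : ∀ z ∈ V, deriv f z ≠ 0)
    (hf0 : ∀ z ∈ V, f z ≠ 0)
    (hf1728 : ∀ z ∈ V, f z ≠ 1728)
    (heq : ∀ z ∈ V,
      2 * deriv (deriv (deriv f)) z * deriv f z * f z ^ 2 * (f z - 1728) ^ 2
        - 3 * (deriv (deriv f) z) ^ 2 * f z ^ 2 * (f z - 1728) ^ 2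
        + 2 * (deriv f z) ^ 4 * (f z ^ 2 - 1968 * f z + 2654208) = 0)
    (htr : ¬ ∃ P : MvPolynomial (Fin 2) ℂ, P ≠ 0 ∧
      ∀ z ∈ V, MvPolynomial.eval ![z, f z] P = 0) :
    ¬ ∃ (l : ℕ) (g : Fin l → ℂ → ℝ), RPfaffianChain V g ∧
      AlgebraicOverRChain V g (fun z => (f z).re) ∧
      AlgebraicOverRChain V g (fun z => (f z).im) := by
  rintro ⟨l, g, ⟨hga, hgd⟩, ⟨nu, cu, ⟨ku, hku⟩, hu⟩, ⟨nv, cv, ⟨kv, hkv⟩, hv⟩⟩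
  obtain ⟨z0, hz0, hku0, hkv0⟩ := exists_good_point V hVo hVc g hga (cu ku) (cv kv) hku hkv
  obtain ⟨Ω, i1, i2, D, Ψ, hline, hgerm, hder, hne, hzero⟩ := exists_germ z0
  have hVn : ∀ᶠ z in 𝓝 z0, z ∈ V := hVo.mem_nhds hz0
  -- the germs
  have hfC : AnalyticOnNhd ℂ f V := hf.analyticOnNhd hVo
  have hf1C : AnalyticOnNhd ℂ (deriv f) V := hfC.deriv
  have hf2C : AnalyticOnNhd ℂ (deriv (deriv f)) V := hf1C.deriv
  have hf3C : AnalyticOnNhd ℂ (deriv (deriv (deriv f))) V := hf2C.deriv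
  let bz : germAlg z0 := ⟨fun z => z, analyticAt_id⟩
  let bx : germAlg z0 := ⟨fun z => (z.re : ℂ),
    (Complex.ofRealCLM.analyticAt _).fun_comp (Complex.reCLM.analyticAt z0)⟩
  let bY : germAlg z0 := ⟨fun z => (z.im : ℂ),
    (Complex.ofRealCLM.analyticAt _).fun_comp (Complex.imCLM.analyticAt z0)⟩
  let bg : Fin l → germAlg z0 := fun i => ⟨fun z => (g i z : ℂ),
    (Complex.ofRealCLM.analyticAt _).fun_comp (hga i z0 hz0)⟩
  let bf : germAlg z0 := ⟨f, (hfC z0 hz0).restrictScalars⟩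
  let bf1 : germAlg z0 := ⟨deriv f, (hf1C z0 hz0).restrictScalars⟩
  let bf2 : germAlg z0 := ⟨deriv (deriv f), (hf2C z0 hz0).restrictScalars⟩
  let bf3 : germAlg z0 := ⟨deriv (deriv (deriv f)), (hf3C z0 hz0).restrictScalars⟩
  let bu : germAlg z0 := ⟨fun z => ((f z).re : ℂ), (Complex.ofRealCLM.analyticAt _).fun_comp
    ((Complex.reCLM.analyticAt _).fun_comp (hfC z0 hz0).restrictScalars)⟩
  let bv : germAlg z0 := ⟨fun z => ((f z).im : ℂ), (Complex.ofRealCLM.analyticAt _).fun_comp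
    ((Complex.imCLM.analyticAt _).fun_comp (hfC z0 hz0).restrictScalars)⟩
  let G : ℕ → Ω := fun n => if h : n < l then Ψ (bg ⟨n, h⟩) else 0
  have hG : ∀ j : Fin l, G j = Ψ (bg j) := fun j => by
    simp only [G, j.isLt, dif_pos, Fin.eta]
  have hz_mem : ∀ n, Ψ bz ∈ towerField (Ψ bz) G n := fun n =>
    IntermediateField.subset_adjoin _ _ (Or.inl rfl)
  have hG_mem : ∀ n m, m < n → G m ∈ towerField (Ψ bz) G n := fun n m hmn =>
    IntermediateField.subset_adjoin _ _ (Or.inr ⟨m, hmn, rfl⟩)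
  have hY : Ψ bY = algebraMap ℂ Ω (z0.im : ℂ) := by
    rw [← Ψ.commutes]
    apply hline
    intro t
    change (((z0 + t).im : ℝ) : ℂ) = (z0.im : ℂ)
    simp
  have hX : Ψ bx = Ψ bz - algebraMap ℂ Ω (Complex.I * z0.im) := by
    rw [← Ψ.commutes, ← map_sub]
    apply hline
    intro t
    change (((z0 + t).re : ℝ) : ℂ) = (z0 + t) - Complex.I * z0.im
    apply Complex.ext <;> simp
  have hY_mem : ∀ n, Ψ bY ∈ towerField (Ψ bz) G n := fun n => by
    rw [hY]; exact IntermediateField.algebraMap_mem _ _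
  have hX_mem : ∀ n, Ψ bx ∈ towerField (Ψ bz) G n := fun n => by
    rw [hX]; exact sub_mem (hz_mem n) (IntermediateField.algebraMap_mem _ _)
  have hΨcoord : ∀ {m : ℕ} (W : Fin m → germAlg z0) (Q : MvPolynomial (Fin (m + 2)) ℂ),
      Ψ (MvPolynomial.aeval (coordVec bx bY W) Q) =
      MvPolynomial.aeval (coordVec (Ψ bx) (Ψ bY) fun j => Ψ (W j)) Q := by
    intro m W Q
    rw [MvPolynomial.comp_aeval_apply, map_coordVec (fun a => Ψ a)]
  -- algebraicity over the top of the tower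
  have halg : ∀ (n : ℕ) (c : Fin (n + 1) → MvPolynomial (Fin (l + 2)) ℝ) (k0 : Fin (n + 1))
      (_ : MvPolynomial.eval (Fin.cons z0.re (Fin.cons z0.im fun j => g j z0)) (c k0) ≠ 0)
      (b : germAlg z0) (u : ℂ → ℝ) (_ : ∀ z, b.1 z = (u z : ℂ))
      (_ : ∀ z ∈ V, ∑ k : Fin (n + 1), MvPolynomial.eval
        (Fin.cons z.re (Fin.cons z.im fun j => g j z)) (c k) * u z ^ (k : ℕ) = 0),
      IsAlgebraic (towerField (Ψ bz) G l) (Ψ b) := by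
    intro n c k0 hk0 b u hb hrel
    let C : Fin (n + 1) → germAlg z0 := fun k =>
      MvPolynomial.aeval (coordVec bx bY bg) ((c k).map Complex.ofRealHom)
    have hCz : ∀ k z, (C k).1 z = ((MvPolynomial.eval
        (Fin.cons z.re (Fin.cons z.im fun j => g j z)) (c k) : ℝ) : ℂ) := fun k z =>
      germ_coord bx bY bg g z rfl rfl (fun _ => rfl) (c k)
    refine isAlg_of_rel _ n (fun k => Ψ (C k)) ?_ k0 ?_ _ ?_
    · intro k
      change Ψ (MvPolynomial.aeval (coordVec bx bY bg) _) ∈ _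
      rw [hΨcoord]
      refine aeval_mem_field _ _ _ _ (hX_mem l) (hY_mem l) (fun j => ?_) _
      rw [← hG]
      exact hG_mem l j j.isLt
    · apply hne
      change (C k0).1 z0 ≠ 0
      rw [hCz]
      exact_mod_cast hk0
    · have : Ψ (∑ k : Fin (n + 1), C k * b ^ (k : ℕ)) = Ψ 0 := by
        apply hgerm
        filter_upwards [hVn] with z hz
        have h1 := hrel z hz
        have h2 : (∑ k : Fin (n + 1), C k * b ^ (k : ℕ)).1 z =
            ∑ k : Fin (n + 1), (C k).1 z * b.1 z ^ (k : ℕ) := by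
          have := map_sum ((Pi.evalAlgHom ℂ (fun _ : ℂ => ℂ) z).comp (germAlg z0).val)
            (fun k : Fin (n + 1) => C k * b ^ (k : ℕ)) Finset.univ
          exact this
        change (∑ k : Fin (n + 1), C k * b ^ (k : ℕ)).1 z = 0
        rw [h2]
        simp only [hCz, hb]
        exact_mod_cast h1
      rw [map_zero, map_sum] at this
      simpa only [map_mul, map_pow] using this
  have hFalg : IsAlgebraic (towerField (Ψ bz) G l) (Ψ bf) := by
    have h1 := halg nu cu ku hku0 bu _ (fun _ => rfl) hu
    have h2 := halg nv cv kv hkv0 bv _ (fun _ => rfl) hv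
    have h3 : Ψ bf = Ψ bu + Ψ bv * algebraMap ℂ Ω Complex.I := by
      rw [← Ψ.commutes, ← map_mul, ← map_add]
      apply hline
      intro t
      exact (Complex.re_add_im (f (z0 + t))).symm
    rw [h3]
    refine h1.add (h2.mul ?_)
    exact isAlgebraic_algebraMap (⟨algebraMap ℂ Ω Complex.I,
      IntermediateField.algebraMap_mem _ _⟩ : towerField (Ψ bz) G l)
  -- derivatives
  have hDf : D (Ψ bf) = Ψ bf1 := hder _ _ (hVn.mono fun z hz =>
    hasDerivAt_of_complex (hfC z hz).differentiableAt)
  have hDf1 : D (Ψ bf1) = Ψ bf2 := hder _ _ (hVn.mono fun z hz =>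
    hasDerivAt_of_complex (hf1C z hz).differentiableAt)
  have hDf2 : D (Ψ bf2) = Ψ bf3 := hder _ _ (hVn.mono fun z hz =>
    hasDerivAt_of_complex (hf2C z hz).differentiableAt)
  have hDz : D (Ψ bz) = 1 := by
    rw [← map_one Ψ]
    refine hder _ _ (Eventually.of_forall fun z => ?_)
    have := hasDerivAt_of_complex (f := fun z => z) (z := z) differentiableAt_id
    rwa [deriv_id''] at this
  have hDG : ∀ n, D (G n) ∈ towerField (Ψ bz) G (n + 1) := by
    intro n
    by_cases hn : n < l
    swap
    · have : G n = 0 := by simp only [G, hn, dif_neg, not_false_eq_true]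
      rw [this, map_zero]; exact zero_mem _
    obtain ⟨p, q, hpq⟩ := hgd ⟨n, hn⟩
    let W : Fin (n + 1) → germAlg z0 := fun j => bg (Fin.castLE hn j)
    have h1 : D (Ψ (bg ⟨n, hn⟩)) =
        Ψ (MvPolynomial.aeval (coordVec bx bY W) (p.map Complex.ofRealHom)) := by
      apply hder
      filter_upwards [hVn] with z hz
      have h2 := germ_coord bx bY W (fun j => g (Fin.castLE hn j)) z rfl rfl (fun _ => rfl) p
      have h3 := hasDerivAt_of_real (hga ⟨n, hn⟩ z hz).differentiableAt
      rw [(hpq z hz).1] at h3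
      rw [h2]
      exact h3
    rw [show G n = Ψ (bg ⟨n, hn⟩) from hG ⟨n, hn⟩, h1, hΨcoord]
    refine aeval_mem_field _ _ _ _ (hX_mem _) (hY_mem _) (fun j => ?_) _
    rw [← hG]
    exact hG_mem _ _ j.isLt
  have hE : 2 * Ψ bf3 * Ψ bf1 * Ψ bf ^ 2 * (Ψ bf - 1728) ^ 2
      - 3 * Ψ bf2 ^ 2 * Ψ bf ^ 2 * (Ψ bf - 1728) ^ 2
      + 2 * Ψ bf1 ^ 4 * (Ψ bf ^ 2 - 1968 * Ψ bf + 2654208) = 0 := by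
    have : Ψ (2 * bf3 * bf1 * bf ^ 2 * (bf - 1728) ^ 2
      - 3 * bf2 ^ 2 * bf ^ 2 * (bf - 1728) ^ 2
      + 2 * bf1 ^ 4 * (bf ^ 2 - 1968 * bf + 2654208)) = Ψ 0 := by
      apply hgerm
      filter_upwards [hVn] with z hz
      exact heq z hz
    simpa only [map_add, map_sub, map_mul, map_pow, map_ofNat, map_zero] using this
  have hmain := tower_thm (D.restrictScalars ℤ) (fun c => D.map_algebraMap c) (Ψ bz) G
    (by change D (Ψ bz) ∈ _; rw [hDz]; exact one_mem _) hDG (Ψ bf)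
    (hne bf (hf0 z0 hz0))
    (by
      have := hne (bf - 1728) (sub_ne_zero.mpr (hf1728 z0 hz0))
      rw [map_sub, map_ofNat] at this
      exact sub_ne_zero.mp this)
    (by change D (Ψ bf) ≠ 0; rw [hDf]; exact hne bf1 (hf' z0 hz0))
    (by
      change 2 * D (D (D (Ψ bf))) * D (Ψ bf) * Ψ bf ^ 2 * (Ψ bf - 1728) ^ 2
        - 3 * D (D (Ψ bf)) ^ 2 * Ψ bf ^ 2 * (Ψ bf - 1728) ^ 2
        + 2 * D (Ψ bf) ^ 4 * (Ψ bf ^ 2 - 1968 * Ψ bf + 2654208) = 0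
      rw [hDf, hDf1, hDf2]
      exact hE) l hFalg
  obtain ⟨P, hP0, hP⟩ := exists_mv _ _ _ hmain
  apply htr
  refine ⟨P, hP0, ?_⟩
  have hvec : ∀ z, (fun i => ((![bz, bf] : Fin 2 → germAlg z0) i).1 z) = ![z, f z] := fun z => by
    funext i
    fin_cases i <;> rfl
  have hPz : ∀ᶠ t : ℝ in 𝓝 0, MvPolynomial.eval ![z0 + t, f (z0 + t)] P = 0 := by
    have h1 : Ψ (MvPolynomial.aeval ![bz, bf] P) = 0 := by
      rw [MvPolynomial.comp_aeval_apply, ← hP]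
      congr 2
      funext i
      fin_cases i <;> rfl
    filter_upwards [hzero _ h1] with t ht
    rw [← hvec, ← germ_aeval_apply]
    exact ht
  have hPa : AnalyticOnNhd ℂ (fun z => MvPolynomial.eval ![z, f z] P) V := by
    intro z hz
    have := AnalyticAt.aeval_mvPolynomial (𝕜 := ℂ) (f := fun z => ![z, f z]) (z := z) (fun i => by
      fin_cases i
      · exact analyticAt_id
      · exact hfC z hz) P
    exact this
  refine hPa.eqOn_zero_of_preconnected_of_frequently_eq_zero hVc hz0 ?_
  have ht : Tendsto (fun t : ℝ => z0 + (t : ℂ)) (𝓝[≠] 0) (𝓝[≠] z0) := by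
    refine tendsto_nhdsWithin_iff.mpr ⟨(path_tendsto z0).mono_left nhdsWithin_le_nhds, ?_⟩
    filter_upwards [self_mem_nhdsWithin] with t ht
    simpa using ht
  exact ht.frequently (hPz.filter_mono nhdsWithin_le_nhds).frequently
end

section
/- Let U ⊆ ℂ be a connected open set, identified with an open subset of ℝ² via z = x + iy, and let f be holomorphic on U and transcendental over ℂ(z) in 𝓜(U). Suppose h ≥ 2 and P ∈ ℂ[T, Y₀, Y₁, …, Y_h] is a polynomial genuinely involving Y_h such that P(z, f(z), f′(z), …, f⁽ʰ⁾(z)) = 0 for all z ∈ U, and suppose the equation P = 0 is strongly minimal in the transcendence sense. Then there is no Pfaffian chain (g₁, …, g_l) of real-analytic functions on U such that both Re f and Im f, viewed as real-analytic functions of (x, y) ∈ U, are algebraic over ℝ(x, y, g₁, …, g_l). -/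
section Algebraic

open IntermediateField in
/-- Two elements algebraic over `K(g)` are algebraically dependent over `K`. -/
lemma not_algIndep_pair {K E : Type*} [Field K] [Field E] [Algebra K E] (g a b : E)
    (hab : a ≠ b)
    (ha : IsAlgebraic K⟮g⟯ a) (hb : IsAlgebraic K⟮g⟯ b) :
    ¬ AlgebraicIndepOn K id ({a, b} : Set E) := by
  intro hI
  have key : ∀ x : E, IsAlgebraic K⟮g⟯ x →
      x ∈ (AlgebraicIndependent.matroid K E).closure {g} := by
    intro x hx
    rw [AlgebraicIndependent.matroid_closure_eq]
    exact IntermediateField.isAlgebraic_adjoin_iff.mp hx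
  have hI' : (AlgebraicIndependent.matroid K E).Indep {a, b} := hI
  have hsub : ({a, b} : Set E) ⊆ (AlgebraicIndependent.matroid K E).closure {g} := by
    rintro x (rfl | rfl)
    · exact key _ ha
    · exact key _ hb
  have h1 := hI'.encard_le_eRk_of_subset hsub
  rw [Matroid.eRk_closure_eq, Set.encard_pair hab] at h1
  have h2 := (AlgebraicIndependent.matroid K E).eRk_le_encard {g}
  rw [Set.encard_singleton] at h2
  have := h1.trans h2
  norm_num at this

/-- The algebraic closure of a differential subfield is closed under the derivation. -/
lemma deriv_isAlgebraic {k E : Type*} [Field k] [Field E] [CharZero E] [Algebra k E]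
    (D : Derivation k E E) (K : IntermediateField k E) (hK : ∀ x ∈ K, D x ∈ K)
    (a : E) (ha : IsAlgebraic K a) : IsAlgebraic K (D a) := by
  have : CharZero K := (algebraMap K E).charZero
  have hintg : IsIntegral K a := ha.isIntegral
  have hsep : (minpoly K a).Separable := (minpoly.irreducible hintg).separable
  have hne : Polynomial.aeval a (Polynomial.derivative (minpoly K a)) ≠ 0 :=
    hsep.aeval_derivative_ne_zero (minpoly.aeval K a)
  have h0 : ∀ p : Polynomial K, ∃ y : E, IsAlgebraic K y ∧
      D (Polynomial.aeval a p) = y + Polynomial.aeval a (Polynomial.derivative p) * D a := by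
    intro p
    induction p using Polynomial.induction_on' with
    | add p q hp hq =>
      obtain ⟨y, hy, e⟩ := hp
      obtain ⟨y', hy', e'⟩ := hq
      refine ⟨y + y', hy.add hy', ?_⟩
      simp only [map_add, e, e']; ring
    | monomial n c =>
      refine ⟨D (c : E) * a ^ n, ?_, ?_⟩
      · exact (isAlgebraic_algebraMap (⟨D c, hK _ c.2⟩ : K)).mul (ha.pow n)
      · simp only [Polynomial.aeval_monomial, Derivation.leibniz, Derivation.leibniz_pow,
          Polynomial.derivative_monomial, map_mul, map_natCast, smul_eq_mul, nsmul_eq_mul]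
        change (c : E) * _ + _ * D (c : E) = _ + (c : E) * _ * _ * _
        ring
  obtain ⟨y, hy, e⟩ := h0 (minpoly K a)
  rw [minpoly.aeval, map_zero] at e
  have e2 : D a = - y * (Polynomial.aeval a (Polynomial.derivative (minpoly K a)))⁻¹ := by
    field_simp
    linear_combination -e
  rw [e2]
  refine hy.neg.mul (IsAlgebraic.inv ?_)
  have hle : Algebra.adjoin K {a} ≤ integralClosure K E :=
    Algebra.adjoin_le (by rintro x rfl; exact hintg)
  exact IsIntegral.isAlgebraic (hle (Polynomial.aeval_mem_adjoin_singleton K a))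

/-- A derivation maps `K(S)` into itself once it maps `K` and `S` into it. -/
lemma deriv_adjoin_mem {k E : Type*} [Field k] [Field E] [Algebra k E]
    (D : Derivation k E E) (K : IntermediateField k E) (hK : ∀ x ∈ K, D x ∈ K) (g : E)
    (hg : D g ∈ IntermediateField.adjoin K {g}) :
    ∀ x ∈ IntermediateField.adjoin K {g}, D x ∈ IntermediateField.adjoin K {g} := by
  intro x hx
  induction hx using IntermediateField.adjoin_induction with
  | mem x hx => rw [Set.mem_singleton_iff.mp hx]; exact hg
  | algebraMap x => exact (IntermediateField.adjoin K {g}).algebraMap_mem ⟨D x, hK _ x.2⟩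
  | add x y hx hy h1 h2 => rw [map_add]; exact add_mem h1 h2
  | inv x hx h1 =>
    rw [Derivation.leibniz_inv, smul_eq_mul]
    exact mul_mem (neg_mem (pow_mem (inv_mem hx) 2)) h1
  | mul x y hx hy h1 h2 =>
    rw [Derivation.leibniz]
    exact add_mem (mul_mem hx h2) (mul_mem hy h1)

/-- The tower `ℂ(z)`, `ℂ(z, G 0)`, `ℂ(z, G 0, G 1)`, … -/
noncomputable def tower {E : Type} [Field E] [Algebra ℂ E] (z : E) (G : ℕ → E) :
    ℕ → IntermediateField ℂ E
  | 0 => IntermediateField.adjoin ℂ {z}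
  | n + 1 => (IntermediateField.adjoin (tower z G n) {G n}).restrictScalars ℂ

lemma tower_succ_le {E : Type} [Field E] [Algebra ℂ E] (z : E) (G : ℕ → E) (n : ℕ) :
    tower z G n ≤ tower z G (n + 1) := fun x hx =>
  (IntermediateField.adjoin (tower z G n) {G n}).algebraMap_mem ⟨x, hx⟩

lemma tower_mono {E : Type} [Field E] [Algebra ℂ E] (z : E) (G : ℕ → E) :
    Monotone (tower z G) := monotone_nat_of_le_succ (tower_succ_le z G)

lemma mem_tower {E : Type} [Field E] [Algebra ℂ E] (z : E) (G : ℕ → E) {m n : ℕ}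
    (h : m < n) : G m ∈ tower z G n :=
  tower_mono z G h (IntermediateField.mem_adjoin_simple_self (tower z G m) (G m))

lemma z_mem_tower {E : Type} [Field E] [Algebra ℂ E] (z : E) (G : ℕ → E) (n : ℕ) :
    z ∈ tower z G n :=
  tower_mono z G (Nat.zero_le n) (IntermediateField.mem_adjoin_simple_self ℂ z)

lemma tower_closed {E : Type} [Field E] [Algebra ℂ E] (D : Derivation ℂ E E)
    (z : E) (hz : D z = 1) (G : ℕ → E) (hG : ∀ n, D (G n) ∈ tower z G (n + 1)) (n : ℕ) :
    ∀ x ∈ tower z G n, D x ∈ tower z G n := by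
  induction n with
  | zero =>
    intro x hx
    change x ∈ IntermediateField.adjoin ℂ {z} at hx
    change D x ∈ IntermediateField.adjoin ℂ {z}
    induction hx using IntermediateField.adjoin_induction with
    | mem x hx => rw [Set.mem_singleton_iff.mp hx, hz]; exact one_mem _
    | algebraMap x => rw [Derivation.map_algebraMap]; exact zero_mem _
    | add x y hx hy h1 h2 => rw [map_add]; exact add_mem h1 h2
    | inv x hx h1 =>
      rw [Derivation.leibniz_inv, smul_eq_mul]
      exact mul_mem (neg_mem (pow_mem (inv_mem hx) 2)) h1
    | mul x y hx hy h1 h2 =>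
      rw [Derivation.leibniz]
      exact add_mem (mul_mem hx h2) (mul_mem hy h1)
  | succ n ih => exact deriv_adjoin_mem D (tower z G n) ih (G n) (hG n)

theorem not_algebraic_tower {E : Type} [Field E] [CharZero E] [Algebra ℂ E]
    (D : Derivation ℂ E E)
    (z : E) (hz : D z = 1) (G : ℕ → E) (hG : ∀ n, D (G n) ∈ tower z G (n + 1))
    (f : E) (hind : AlgebraicIndependent ℂ ![z, f])
    (h : ℕ) (hh : 2 ≤ h) (P : MvPolynomial (Fin (h + 2)) ℂ) (hsm : StronglyMinimalODE h P)
    (hP : MvPolynomial.eval₂ (algebraMap ℂ E)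
      (Fin.cons z fun i : Fin (h + 1) => D^[(i : ℕ)] f) P = 0) (n : ℕ) :
    ¬ IsAlgebraic (tower z G n) f := by
  induction n with
  | zero =>
    have h1 := hind.transcendental_adjoin (s := {0}) (i := 1) (by simp)
    rw [Set.image_singleton] at h1
    change Transcendental (Algebra.adjoin ℂ {z}) f at h1
    intro h2
    exact h1 (IntermediateField.isAlgebraic_adjoin_iff.mp h2)
  | succ n ih =>
    intro hf
    have hcl := tower_closed D z hz G hG
    have hDf : IsAlgebraic (tower z G (n + 1)) (D f) := deriv_isAlgebraic D _ (hcl (n + 1)) f hf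
    have := hsm E D (map_add D) (fun x y => by rw [Derivation.leibniz]; simp; ring)
      (tower z G n).toSubfield (hcl n) (algebraMap ℂ E)
      (fun c => (tower z G n).algebraMap_mem c) (fun c => D.map_algebraMap c) z
      (z_mem_tower z G n) hz f hP
    rcases this with h1 | h1
    · exact ih h1
    · have h1' : AlgebraicIndependent (tower z G n) fun i : Fin h => D^[(i : ℕ)] f := h1
      have hne : f ≠ D f := by
        intro e
        have := h1'.injective (a₁ := ⟨0, by omega⟩) (a₂ := ⟨1, by omega⟩) (by simpa using e)
        simp at this
      refine not_algIndep_pair (K := tower z G n) (G n) f (D f) hne hf hDf ?_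
      have h3 := h1'.to_subtype_range
      refine AlgebraicIndepOn.mono
        (t := Set.range fun i : Fin h => D^[(i : ℕ)] f) h3 ?_
      rintro x (rfl | rfl)
      · exact ⟨⟨0, by omega⟩, rfl⟩
      · exact ⟨⟨1, by omega⟩, rfl⟩

end Algebraic

section Frac

/-- A derivation of a domain extends to the fraction field. -/
theorem exists_deriv_extension {k A K : Type} [Field k] [CommRing A] [IsDomain A] [Algebra k A]
    [Field K] [Algebra A K] [Algebra k K] [IsScalarTower k A K] [IsFractionRing A K]
    (d : Derivation k A A) :
    ∃ D : Derivation k K K, ∀ a : A, D (algebraMap A K a) = algebraMap A K (d a) := by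
  let φ : A →+* TrivSqZeroExt K K :=
    { toFun := fun a => TrivSqZeroExt.inl (algebraMap A K a) +
        TrivSqZeroExt.inr (algebraMap A K (d a))
      map_one' := by ext <;> simp
      map_zero' := by ext <;> simp
      map_add' := fun a b => by
        ext
        · simp
        · simp; rw [Algebra.smul_def, Algebra.smul_def]; ring
      map_mul' := fun a b => by
        ext
        · simp
        · simp; rw [Algebra.smul_def, Algebra.smul_def]; ring }
  have hφ : ∀ y : nonZeroDivisors A, IsUnit (φ y) := by
    intro y
    rw [TrivSqZeroExt.isUnit_iff_isUnit_fst]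
    simp [φ]
  let ψ : K →+* TrivSqZeroExt K K := IsLocalization.lift hφ
  have hψ : ∀ a, ψ (algebraMap A K a) = φ a := fun a => IsLocalization.lift_eq hφ a
  have hfst : ∀ x, (ψ x).fst = x := by
    intro x
    have : ((TrivSqZeroExt.fstHom K K K : TrivSqZeroExt K K →ₐ[K] K) : TrivSqZeroExt K K →+* K).comp ψ
        = RingHom.id K := by
      apply IsLocalization.ringHom_ext (nonZeroDivisors A)
      ext a
      simp [hψ, φ]
    exact congrArg (fun r : K →+* K => r x) this
  have hk : ∀ c : k, ψ (algebraMap k K c) = TrivSqZeroExt.inl (algebraMap k K c) := by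
    intro c
    rw [IsScalarTower.algebraMap_apply k A K, hψ]
    simp [φ]
  refine ⟨Derivation.mk' (R := k)
    { toFun := fun x => (ψ x).snd
      map_add' := fun x y => by simp
      map_smul' := fun c x => by
        rw [Algebra.smul_def, map_mul, hk]
        simp [Algebra.smul_def] } ?_, ?_⟩
  · intro x y
    simp [hfst]; ring
  · intro a
    simp [hψ, φ]; rw [Algebra.smul_def, mul_one]

end Frac

section Analytic

/-- Complex-valued real-analytic functions on `U`. -/
def anSub (U : Set ℂ) : Subalgebra ℂ (U → ℂ) where
  carrier := {u | ∃ v : ℂ → ℂ, AnalyticOnNhd ℝ v U ∧ u = fun z : U => v z}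
  mul_mem' := by
    rintro _ _ ⟨v, hv, rfl⟩ ⟨w, hw, rfl⟩
    exact ⟨fun z => v z * w z, hv.mul hw, rfl⟩
  add_mem' := by
    rintro _ _ ⟨v, hv, rfl⟩ ⟨w, hw, rfl⟩
    exact ⟨fun z => v z + w z, hv.add hw, rfl⟩
  algebraMap_mem' := fun c => ⟨fun _ => c, analyticOnNhd_const, rfl⟩

/-- The restriction of an analytic function. -/
def anMk {U : Set ℂ} (v : ℂ → ℂ) (hv : AnalyticOnNhd ℝ v U) : anSub U :=
  ⟨fun z => v z, v, hv, rfl⟩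

lemma anMk_apply {U : Set ℂ} (v : ℂ → ℂ) (hv : AnalyticOnNhd ℝ v U) (z : U) :
    (anMk v hv).1 z = v z := rfl

lemma anMk_eq {U : Set ℂ} {v w : ℂ → ℂ} (hv : AnalyticOnNhd ℝ v U) (hw : AnalyticOnNhd ℝ w U)
    (h : ∀ z ∈ U, v z = w z) : anMk v hv = anMk w hw :=
  Subtype.ext (funext fun z => h z z.2)

lemma exists_anMk {U : Set ℂ} (a : anSub U) : ∃ v, ∃ hv : AnalyticOnNhd ℝ v U, a = anMk v hv := by
  obtain ⟨u, v, hv, rfl⟩ := a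
  exact ⟨v, hv, rfl⟩

/-- `∂/∂z`. -/
noncomputable def dz (v : ℂ → ℂ) (z : ℂ) : ℂ :=
  (fderiv ℝ v z 1 - Complex.I * fderiv ℝ v z Complex.I) / 2

lemma dz_analytic {U : Set ℂ} {v : ℂ → ℂ} (hv : AnalyticOnNhd ℝ v U) :
    AnalyticOnNhd ℝ (dz v) U := by
  have h := hv.fderiv
  have h1 : ∀ w : ℂ, AnalyticOnNhd ℝ (fun z => fderiv ℝ v z w) U := fun w =>
    (ContinuousLinearMap.apply ℝ ℂ w).comp_analyticOnNhd h
  exact ((h1 1).sub (analyticOnNhd_const.mul (h1 Complex.I))).div_const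

lemma dz_congr {U : Set ℂ} (hU : IsOpen U) {v w : ℂ → ℂ} (h : ∀ z ∈ U, v z = w z) :
    ∀ z ∈ U, dz v z = dz w z := by
  intro z hz
  have : v =ᶠ[nhds z] w := Filter.eventuallyEq_of_mem (hU.mem_nhds hz) h
  unfold dz
  rw [this.fderiv_eq]

/-- `∂/∂z` on `anSub U`. -/
noncomputable def dAfun {U : Set ℂ} (a : anSub U) : anSub U :=
  anMk (dz (exists_anMk a).choose) (dz_analytic (exists_anMk a).choose_spec.choose)

lemma dAfun_mk {U : Set ℂ} (hU : IsOpen U) (v : ℂ → ℂ) (hv : AnalyticOnNhd ℝ v U) :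
    dAfun (anMk v hv) = anMk (dz v) (dz_analytic hv) := by
  apply anMk_eq
  apply dz_congr hU
  intro z hz
  have := (exists_anMk (anMk v hv)).choose_spec.choose_spec
  exact (congrArg (fun a : anSub U => a.1 ⟨z, hz⟩) this).symm

/-- `∂/∂z` as a derivation. -/
noncomputable def dA {U : Set ℂ} (hU : IsOpen U) : Derivation ℂ (anSub U) (anSub U) :=
  Derivation.mk' (R := ℂ)
    { toFun := dAfun
      map_add' := by
        intro a b
        obtain ⟨v, hv, rfl⟩ := exists_anMk a
        obtain ⟨w, hw, rfl⟩ := exists_anMk b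
        have e : anMk v hv + anMk w hw = anMk (fun z => v z + w z) (hv.add hw) := rfl
        rw [e, dAfun_mk hU, dAfun_mk hU, dAfun_mk hU]
        refine Subtype.ext (funext fun z => ?_)
        change dz (fun z => v z + w z) z = dz v z + dz w z
        unfold dz
        rw [fderiv_fun_add (hv z z.2).differentiableAt (hw z z.2).differentiableAt]
        simp only [add_apply]
        ring
      map_smul' := by
        intro c a
        obtain ⟨v, hv, rfl⟩ := exists_anMk a
        have e : c • anMk v hv = anMk (fun z => c * v z) (analyticOnNhd_const.mul hv) := rfl
        rw [e, dAfun_mk hU, dAfun_mk hU]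
        refine Subtype.ext (funext fun z => ?_)
        change dz (fun z => c * v z) z = c * dz v z
        unfold dz
        rw [fderiv_const_mul (hv z z.2).differentiableAt]
        simp only [smul_apply, smul_eq_mul]
        ring }
    (by
      intro a b
      obtain ⟨v, hv, rfl⟩ := exists_anMk a
      obtain ⟨w, hw, rfl⟩ := exists_anMk b
      have e : anMk v hv * anMk w hw = anMk (fun z => v z * w z) (hv.mul hw) := rfl
      change dAfun (anMk v hv * anMk w hw) = anMk v hv * dAfun (anMk w hw)
        + anMk w hw * dAfun (anMk v hv)
      rw [e, dAfun_mk hU, dAfun_mk hU, dAfun_mk hU]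
      refine Subtype.ext (funext fun z => ?_)
      change dz (fun z => v z * w z) z = v z * dz w z + w z * dz v z
      unfold dz
      rw [fderiv_fun_mul (hv z z.2).differentiableAt (hw z z.2).differentiableAt]
      simp only [add_apply, smul_apply, smul_eq_mul]
      ring)

lemma dA_mk {U : Set ℂ} (hU : IsOpen U) (v : ℂ → ℂ) (hv : AnalyticOnNhd ℝ v U) :
    dA hU (anMk v hv) = anMk (dz v) (dz_analytic hv) := dAfun_mk hU v hv

lemma anSub_isDomain {U : Set ℂ} (hU : IsOpen U) (hUc : IsPreconnected U) (hne : U.Nonempty) :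
    IsDomain (anSub U) := by
  have : Nonempty U := hne.to_subtype
  have : NoZeroDivisors (anSub U) := by
    refine ⟨fun {a b} hab => ?_⟩
    obtain ⟨v, hv, rfl⟩ := exists_anMk a
    obtain ⟨w, hw, rfl⟩ := exists_anMk b
    by_contra! hcon
    obtain ⟨h1, h2⟩ := hcon
    have hz : ∃ z : U, v z ≠ 0 := by
      by_contra! h
      exact h1 (Subtype.ext (funext h))
    obtain ⟨z, hz⟩ := hz
    have hcont := (hv z z.2).continuousAt.eventually_ne hz
    apply h2
    have hw0 : w =ᶠ[nhds (z : ℂ)] 0 := by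
      filter_upwards [hcont, hU.mem_nhds z.2] with y hy hyU
      have := congrArg (fun a : anSub U => a.1 ⟨y, hyU⟩) hab
      exact (mul_eq_zero.mp this).resolve_left hy
    have := hw.eqOn_zero_of_preconnected_of_eventuallyEq_zero hUc z.2 hw0
    exact Subtype.ext (funext fun y => this y.2)
  exact NoZeroDivisors.to_isDomain _

lemma holo_analytic {U : Set ℂ} (hU : IsOpen U) {f : ℂ → ℂ} (hf : DifferentiableOn ℂ f U) :
    AnalyticOnNhd ℝ f U := (hf.analyticOnNhd hU).restrictScalars

lemma dz_holo {f : ℂ → ℂ} {z : ℂ} (hf : DifferentiableAt ℂ f z) : dz f z = deriv f z := by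
  unfold dz
  have h1 : fderiv ℝ f z = (fderiv ℂ f z).restrictScalars ℝ := hf.fderiv_restrictScalars ℝ
  rw [h1]
  simp only [ContinuousLinearMap.coe_restrictScalars']
  have : fderiv ℂ f z Complex.I = Complex.I * deriv f z := by
    rw [← mul_one Complex.I, ← smul_eq_mul, map_smul]; simp
  rw [this, fderiv_apply_one_eq_deriv]
  linear_combination -(deriv f z) * Complex.I_sq / 2

lemma dz_conj (z : ℂ) : dz (fun w => (starRingEnd ℂ) w) z = 0 := by
  unfold dz
  have : fderiv ℝ (fun w => (starRingEnd ℂ) w) z = (Complex.conjCLE : ℂ →L[ℝ] ℂ) :=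
    (Complex.conjCLE : ℂ →L[ℝ] ℂ).fderiv
  rw [this]
  simp

lemma dz_ofReal {g : ℂ → ℝ} {z : ℂ} (hg : DifferentiableAt ℝ g z) :
    dz (fun w => (g w : ℂ)) z =
      ((fderiv ℝ g z 1 : ℝ) - Complex.I * (fderiv ℝ g z Complex.I : ℝ)) / 2 := by
  unfold dz
  have : fderiv ℝ (fun w => (g w : ℂ)) z = Complex.ofRealCLM.comp (fderiv ℝ g z) :=
    (Complex.ofRealCLM.hasFDerivAt.comp z hg.hasFDerivAt).fderiv
  rw [this]
  simp

lemma ofReal_analytic {U : Set ℂ} {g : ℂ → ℝ} (hg : AnalyticOnNhd ℝ g U) :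
    AnalyticOnNhd ℝ (fun z => (g z : ℂ)) U := Complex.ofRealCLM.comp_analyticOnNhd hg

end Analytic

section Main

lemma evalAt_aeval {U : Set ℂ} {σ : Type*} (w : σ → anSub U) (p : MvPolynomial σ ℂ) (z : U) :
    (MvPolynomial.aeval w p).1 z = MvPolynomial.eval (fun i => (w i).1 z) p := by
  let e : anSub U →ₐ[ℂ] ℂ := (Pi.evalAlgHom ℂ (fun _ : U => ℂ) z).comp (anSub U).val
  have h1 : (MvPolynomial.aeval w p).1 z = e (MvPolynomial.aeval w p) := rfl
  rw [h1, MvPolynomial.comp_aeval_apply, MvPolynomial.aeval_eq_eval]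
  rfl

lemma dA_iterate {U : Set ℂ} (hU : IsOpen U) {f : ℂ → ℂ} (hf : DifferentiableOn ℂ f U) (n : ℕ) :
    ∃ hd : DifferentiableOn ℂ (deriv^[n] f) U,
      (dA hU)^[n] (anMk f (holo_analytic hU hf)) = anMk (deriv^[n] f) (holo_analytic hU hd) := by
  induction n with
  | zero => exact ⟨hf, rfl⟩
  | succ n ih =>
    obtain ⟨hd, e⟩ := ih
    have hd' : DifferentiableOn ℂ (deriv^[n + 1] f) U := by
      rw [Function.iterate_succ_apply']
      exact hd.deriv hU
    refine ⟨hd', ?_⟩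
    rw [Function.iterate_succ_apply', e, dA_mk]
    apply anMk_eq
    intro z hz
    rw [Function.iterate_succ_apply']
    exact dz_holo (hd.differentiableAt (hU.mem_nhds hz))

lemma poly_mem {U : Set ℂ} {E : Type} [Field E] [Algebra ℂ E] (j : anSub U →ₐ[ℂ] E)
    (T : IntermediateField ℂ E) {m : ℕ} (w : Fin m → ℂ → ℝ) (hw : ∀ i, AnalyticOnNhd ℝ (w i) U)
    (hT : ∀ i, j (anMk _ (ofReal_analytic (hw i))) ∈ T) (p : MvPolynomial (Fin m) ℝ) :
    ∃ a : anSub U, j a ∈ T ∧ ∀ z : U, a.1 z = ((MvPolynomial.eval (fun i => w i z) p : ℝ) : ℂ) := by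
  refine ⟨MvPolynomial.aeval (fun i => anMk _ (ofReal_analytic (hw i)))
    (MvPolynomial.map Complex.ofRealHom p), ?_, ?_⟩
  · rw [MvPolynomial.comp_aeval_apply, MvPolynomial.aeval_def]
    exact MvPolynomial.eval₂_mem (s := T.toSubalgebra) (fun d _ => T.algebraMap_mem _) hT
  · intro z
    rw [evalAt_aeval, MvPolynomial.eval_map]
    change MvPolynomial.eval₂ Complex.ofRealHom (fun i => Complex.ofRealHom (w i z)) p = _
    exact (MvPolynomial.eval₂_comp _ _ _).symm

/-- The vector `(x, y, g)` of functions. -/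
def xyVec {m : ℕ} (g : Fin m → ℂ → ℝ) : Fin (m + 2) → ℂ → ℝ :=
  Fin.cons Complex.re (Fin.cons Complex.im g)

lemma xyVec_apply {m : ℕ} (g : Fin m → ℂ → ℝ) (z : ℂ) :
    (Fin.cons z.re (Fin.cons z.im fun j => g j z) : Fin (m + 2) → ℝ) = fun i => xyVec g i z := by
  funext i
  refine Fin.cases rfl (fun i => ?_) i
  refine Fin.cases rfl (fun i => rfl) i

lemma re_analytic (U : Set ℂ) : AnalyticOnNhd ℝ Complex.re U :=
  Complex.reCLM.analyticOnNhd U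

lemma im_analytic (U : Set ℂ) : AnalyticOnNhd ℝ Complex.im U :=
  Complex.imCLM.analyticOnNhd U

lemma xyVec_analytic {U : Set ℂ} {m : ℕ} (g : Fin m → ℂ → ℝ) (hg : ∀ i, AnalyticOnNhd ℝ (g i) U)
    (i) : AnalyticOnNhd ℝ (xyVec g i) U := by
  refine Fin.cases (re_analytic U) (fun i => ?_) i
  exact Fin.cases (im_analytic U) (fun i => hg i) i

lemma alg_of_chain {U : Set ℂ} {E : Type} [Field E] [Algebra ℂ E] (j : anSub U →ₐ[ℂ] E)
    (hj : Function.Injective j)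
    (T : IntermediateField ℂ E) {l : ℕ} (g : Fin l → ℂ → ℝ) (hg : ∀ i, AnalyticOnNhd ℝ (g i) U)
    (hT : ∀ i, j (anMk _ (ofReal_analytic (xyVec_analytic g hg i))) ∈ T)
    (u : ℂ → ℝ) (hu : AnalyticOnNhd ℝ u U) (hal : AlgebraicOverRChain U g u) :
    IsAlgebraic T (j (anMk _ (ofReal_analytic hu))) := by
  obtain ⟨n, c, ⟨k₀, hk₀⟩, hsum⟩ := hal
  choose a haT ha using fun k => poly_mem j T (xyVec g) (xyVec_analytic g hg) hT (c k)
  simp only [xyVec_apply] at hk₀ hsum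
  refine ⟨∑ k : Fin (n + 1), Polynomial.monomial (k : ℕ) (⟨j (a k), haT k⟩ : T), ?_, ?_⟩
  · intro h0
    have := congrArg (fun p => Polynomial.coeff p (k₀ : ℕ)) h0
    simp only [Polynomial.finsetSum_coeff, Polynomial.coeff_monomial, Fin.val_inj,
      Finset.sum_ite_eq', Finset.mem_univ, if_true, Polynomial.coeff_zero] at this
    have h1 : j (a k₀) = 0 := congrArg Subtype.val this
    have h2 : a k₀ = 0 := hj (by rw [h1, map_zero])
    apply hk₀
    intro z hz
    have h3 := ha k₀ ⟨z, hz⟩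
    rw [h2] at h3
    exact Complex.ofReal_eq_zero.mp h3.symm
  · rw [map_sum]
    have : ∀ k : Fin (n + 1), Polynomial.aeval (j (anMk _ (ofReal_analytic hu)))
        (Polynomial.monomial (k : ℕ) (⟨j (a k), haT k⟩ : T)) =
        j (a k * (anMk _ (ofReal_analytic hu)) ^ (k : ℕ)) := by
      intro k
      rw [Polynomial.aeval_monomial, map_mul, map_pow]
      rfl
    simp only [this]
    rw [← map_sum]
    have h0 : ∑ k : Fin (n + 1), a k * (anMk _ (ofReal_analytic hu)) ^ (k : ℕ) = 0 := by
      refine Subtype.ext (funext fun z => ?_)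
      have h1 : (∑ k : Fin (n + 1), a k * (anMk _ (ofReal_analytic hu)) ^ (k : ℕ)).1 z =
          ∑ k : Fin (n + 1), (a k).1 z * (u z : ℂ) ^ (k : ℕ) := by
        simp [anMk]
      rw [h1]
      simp only [ha]
      change _ = (0 : ℂ)
      exact_mod_cast hsum z z.2
    rw [h0, map_zero]

/-- The main argument, with the fraction field abstracted. -/
theorem main_aux (U : Set ℂ) (hUo : IsOpen U)
    (f : ℂ → ℂ) (hf : DifferentiableOn ℂ f U)
    (htr : ¬ ∃ P : MvPolynomial (Fin 2) ℂ, P ≠ 0 ∧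
      ∀ z ∈ U, MvPolynomial.eval ![z, f z] P = 0)
    (h : ℕ) (hh : 2 ≤ h)
    (P : MvPolynomial (Fin (h + 2)) ℂ)
    (hPf : ∀ z ∈ U,
      MvPolynomial.eval (Fin.cons z fun i : Fin (h + 1) => deriv^[(i : ℕ)] f z) P = 0)
    (hsm : StronglyMinimalODE h P)
    (E : Type) [Field E] [CharZero E] [Algebra ℂ E] (j : anSub U →ₐ[ℂ] E)
    (hj : Function.Injective j) (D : Derivation ℂ E E) (hD : ∀ a, D (j a) = j (dA hUo a))
    (l : ℕ) (g : Fin l → ℂ → ℝ) (hchain : RPfaffianChain U g)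
    (hre : AlgebraicOverRChain U g (fun z => (f z).re))
    (him : AlgebraicOverRChain U g (fun z => (f z).im)) : False := by
  obtain ⟨hg, hch⟩ := hchain
  have hzan : AnalyticOnNhd ℝ (fun z : ℂ => z) U := holo_analytic hUo differentiableOn_id
  have hcan : AnalyticOnNhd ℝ (fun w : ℂ => (starRingEnd ℂ) w) U :=
    (Complex.conjCLE : ℂ →L[ℝ] ℂ).analyticOnNhd U
  let zA : anSub U := anMk _ hzan
  let cA : anSub U := anMk _ hcan
  let fA : anSub U := anMk f (holo_analytic hUo hf)
  let gA : Fin l → anSub U := fun i => anMk _ (ofReal_analytic (hg i))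
  let G : ℕ → E := fun n => match n with
    | 0 => j cA
    | n + 1 => if h : n < l then j (gA ⟨n, h⟩) else 0
  have hDz : D (j zA) = 1 := by
    rw [hD, dA_mk, ← map_one j]
    congr 1
    refine Subtype.ext (funext fun z => ?_)
    change dz (fun z => z) z = 1
    rw [dz_holo differentiableAt_fun_id]
    exact deriv_id _
  have hxT : ∀ n, j (anMk _ (ofReal_analytic (re_analytic U))) ∈ tower (j zA) G (n + 1) := by
    intro n
    have e : anMk _ (ofReal_analytic (re_analytic U)) =
        algebraMap ℂ (anSub U) (1 / 2) * (zA + cA) := by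
      refine Subtype.ext (funext fun z => ?_)
      change ((z : ℂ).re : ℂ) = 1 / 2 * ((z : ℂ) + (starRingEnd ℂ) z)
      rw [Complex.add_conj]
      push_cast; ring
    rw [e, map_mul, map_add, AlgHom.commutes]
    exact mul_mem (IntermediateField.algebraMap_mem _ _) (add_mem (z_mem_tower _ _ _)
      (mem_tower (j zA) G (Nat.succ_pos n)))
  have hyT : ∀ n, j (anMk _ (ofReal_analytic (im_analytic U))) ∈ tower (j zA) G (n + 1) := by
    intro n
    have e : anMk _ (ofReal_analytic (im_analytic U)) =
        algebraMap ℂ (anSub U) (- Complex.I / 2) * (zA - cA) := by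
      refine Subtype.ext (funext fun z => ?_)
      change ((z : ℂ).im : ℂ) = - Complex.I / 2 * ((z : ℂ) - (starRingEnd ℂ) z)
      rw [Complex.sub_conj]
      push_cast
      linear_combination ((z : ℂ).im : ℂ) * Complex.I_sq
    rw [e, map_mul, map_sub, AlgHom.commutes]
    exact mul_mem (IntermediateField.algebraMap_mem _ _) (sub_mem (z_mem_tower _ _ _)
      (mem_tower (j zA) G (Nat.succ_pos n)))
  have hgT : ∀ (i : Fin l) (n : ℕ), (i : ℕ) + 1 < n → j (gA i) ∈ tower (j zA) G n := by
    intro i n hin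
    have := mem_tower (j zA) G hin
    have e : G ((i : ℕ) + 1) = j (gA i) := by simp [G]
    rwa [e] at this
  have hG : ∀ n, D (G n) ∈ tower (j zA) G (n + 1) := by
    intro n
    match n with
    | 0 =>
      change D (j cA) ∈ _
      have : dA hUo cA = 0 := by
        rw [dA_mk]
        refine Subtype.ext (funext fun z => ?_)
        exact dz_conj z
      rw [hD, this, map_zero]
      exact zero_mem _
    | n + 1 =>
      by_cases hn : n < l
      · have e : G (n + 1) = j (gA ⟨n, hn⟩) := by simp [G, hn]
        rw [e, hD]
        obtain ⟨p, q, hpq⟩ := hch ⟨n, hn⟩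
        let g' : Fin (n + 1) → ℂ → ℝ := fun k => g (Fin.castLE hn k)
        have hg' : ∀ k, AnalyticOnNhd ℝ (g' k) U := fun k => hg _
        have hT : ∀ i, j (anMk _ (ofReal_analytic (xyVec_analytic g' hg' i))) ∈
            tower (j zA) G (n + 1 + 1) := by
          intro i
          refine Fin.cases (hxT _) (fun i => ?_) i
          refine Fin.cases (hyT _) (fun i => ?_) i
          exact hgT (Fin.castLE hn i) _ (by simp; omega)
        obtain ⟨a, haT, ha⟩ := poly_mem j _ (xyVec g') (xyVec_analytic g' hg') hT p
        obtain ⟨b, hbT, hb⟩ := poly_mem j _ (xyVec g') (xyVec_analytic g' hg') hT q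
        have e2 : dA hUo (gA ⟨n, hn⟩) = algebraMap ℂ (anSub U) (1 / 2) *
            (a - algebraMap ℂ (anSub U) Complex.I * b) := by
          rw [dA_mk]
          refine Subtype.ext (funext fun z => ?_)
          change dz (fun w => (g ⟨n, hn⟩ w : ℂ)) z = 1 / 2 * (a.1 z - Complex.I * b.1 z)
          rw [dz_ofReal (hg _ z z.2).differentiableAt, ha, hb, (hpq z z.2).1, (hpq z z.2).2]
          have e3 := xyVec_apply g' z
          rw [← e3]
          ring
        rw [e2, map_mul, map_sub, map_mul, AlgHom.commutes, AlgHom.commutes]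
        exact mul_mem (IntermediateField.algebraMap_mem _ _) (sub_mem haT
          (mul_mem (IntermediateField.algebraMap_mem _ _) hbT))
      · have e : G (n + 1) = 0 := by simp [G, hn]
        rw [e, map_zero]
        exact zero_mem _
  have hind : AlgebraicIndependent ℂ ![j zA, j fA] := by
    rw [algebraicIndependent_iff]
    intro p hp
    by_contra hp0
    refine htr ⟨p, hp0, fun z hz => ?_⟩
    have e : (![j zA, j fA] : Fin 2 → E) = fun i => j (![zA, fA] i) := by
      funext i; fin_cases i <;> rfl
    rw [e, ← MvPolynomial.comp_aeval_apply] at hp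
    have h1 : MvPolynomial.aeval ![zA, fA] p = 0 := hj (by rw [hp, map_zero])
    have h2 := evalAt_aeval ![zA, fA] p ⟨z, hz⟩
    rw [h1] at h2
    have e2 : (fun i => (![zA, fA] i).1 ⟨z, hz⟩) = ![z, f z] := by
      funext i; fin_cases i <;> rfl
    rw [e2] at h2
    exact h2.symm
  have hDit : ∀ n, D^[n] (j fA) = j ((dA hUo)^[n] fA) := by
    intro n
    induction n with
    | zero => rfl
    | succ n ih => rw [Function.iterate_succ_apply', Function.iterate_succ_apply', ih, hD]
  have hP : MvPolynomial.eval₂ (algebraMap ℂ E)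
      (Fin.cons (j zA) fun i : Fin (h + 1) => D^[(i : ℕ)] (j fA)) P = 0 := by
    let w : Fin (h + 2) → anSub U := Fin.cons zA fun i : Fin (h + 1) => (dA hUo)^[(i : ℕ)] fA
    have e : (Fin.cons (j zA) fun i : Fin (h + 1) => D^[(i : ℕ)] (j fA) : Fin (h + 2) → E) =
        fun i => j (w i) := by
      funext i
      refine Fin.cases rfl (fun i => ?_) i
      exact hDit i
    rw [e, ← MvPolynomial.aeval_def, ← MvPolynomial.comp_aeval_apply]
    have h0 : MvPolynomial.aeval w P = 0 := by
      refine Subtype.ext (funext fun z => ?_)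
      rw [evalAt_aeval]
      refine Eq.trans ?_ (hPf z z.2)
      congr 2
      funext i
      refine Fin.cases rfl (fun i => ?_) i
      obtain ⟨hd, e'⟩ := dA_iterate hUo hf (i : ℕ)
      exact congrArg (fun a : anSub U => a.1 z) e'
    rw [h0, map_zero]
  have hnot := not_algebraic_tower D (j zA) hDz G hG (j fA) hind h hh P hsm hP (l + 1)
  apply hnot
  have hT : ∀ i, j (anMk _ (ofReal_analytic (xyVec_analytic g hg i))) ∈
      tower (j zA) G (l + 1) := by
    intro i
    refine Fin.cases (hxT _) (fun i => ?_) i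
    refine Fin.cases (hyT _) (fun i => ?_) i
    exact hgT i _ (by omega)
  have hfan := holo_analytic hUo hf
  have hra : AnalyticOnNhd ℝ (fun z => (f z).re) U := Complex.reCLM.comp_analyticOnNhd hfan
  have hia : AnalyticOnNhd ℝ (fun z => (f z).im) U := Complex.imCLM.comp_analyticOnNhd hfan
  have h1 := alg_of_chain j hj _ g hg hT _ hra hre
  have h2 := alg_of_chain j hj _ g hg hT _ hia him
  have e : fA = anMk _ (ofReal_analytic hra) +
      algebraMap ℂ (anSub U) Complex.I * anMk _ (ofReal_analytic hia) := by
    refine Subtype.ext (funext fun z => ?_)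
    change f z = ((f z).re : ℂ) + Complex.I * ((f z).im : ℂ)
    rw [mul_comm]
    exact (Complex.re_add_im _).symm
  rw [e, map_add, map_mul, AlgHom.commutes]
  exact h1.add (IsAlgebraic.mul (isAlgebraic_algebraMap
    (⟨algebraMap ℂ E Complex.I, IntermediateField.algebraMap_mem _ _⟩ : tower (j zA) G (l + 1))) h2)

end Main

/-- Let `U ⊆ ℂ` be connected open, `f` holomorphic on `U` and transcendental
over `ℂ(z)`, satisfying a strongly minimal algebraic differential equation of order `h ≥ 2`
genuinely involving `Y_h`.  Then there is no Pfaffian chain of real-analytic functions on `U`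
over which both `Re f` and `Im f` are algebraic. -/
theorem statement_8 (U : Set ℂ) (hUo : IsOpen U) (hUc : IsPreconnected U)
    (f : ℂ → ℂ) (hf : DifferentiableOn ℂ f U)
    (htr : ¬ ∃ P : MvPolynomial (Fin 2) ℂ, P ≠ 0 ∧
      ∀ z ∈ U, MvPolynomial.eval ![z, f z] P = 0)
    (h : ℕ) (hh : 2 ≤ h)
    (P : MvPolynomial (Fin (h + 2)) ℂ)
    (hPY : Fin.last (h + 1) ∈ P.vars)
    (hPf : ∀ z ∈ U,
      MvPolynomial.eval (Fin.cons z fun i : Fin (h + 1) => deriv^[(i : ℕ)] f z) P = 0)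
    (hsm : StronglyMinimalODE h P) :
    ¬ ∃ (l : ℕ) (g : Fin l → ℂ → ℝ), RPfaffianChain U g ∧
      AlgebraicOverRChain U g (fun z => (f z).re) ∧
      AlgebraicOverRChain U g (fun z => (f z).im) := by
  rintro ⟨l, g, hchain, hre, him⟩
  have hne : U.Nonempty := by
    by_contra hcon
    rw [Set.not_nonempty_iff_eq_empty] at hcon
    exact htr ⟨1, one_ne_zero, by simp [hcon]⟩
  have hdom : IsDomain (anSub U) := anSub_isDomain hUo hUc hne
  have hE0 : CharZero (FractionRing (anSub U)) :=
    charZero_of_injective_algebraMap (algebraMap ℂ (FractionRing (anSub U))).injective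
  obtain ⟨D, hD⟩ := exists_deriv_extension (K := FractionRing (anSub U)) (dA hUo)
  exact main_aux U hUo f hf htr h hh P hPf hsm (FractionRing (anSub U))
    (IsScalarTower.toAlgHom ℂ (anSub U) (FractionRing (anSub U)))
    (IsFractionRing.injective (anSub U) (FractionRing (anSub U))) D hD l g hchain hre him
end
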